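/- Let K be a number field, not isomorphic to the 12th cyclotomic field ℚ(ζ₁₂), whose class number is 1, and suppose that condition cond_A(K) or condition cond_B(K) holds. Let L be a quadratic extension of K. Then every non-elementary arithmetic progression of five squares (b₁², b₂², b₃², b₄², b₅²) properly defined over L is equivalent over L to a progression of the form (a₁², a₂², a₃², α·a₄², a₅²) with a₁, a₂, a₃, a₄, a₅, α in (the image of) K and α not a square in K; that is, there exist such a₁,…,a₅, α and a nonzero s ∈ L such that (s²b₁², s²b₂², s²b₃², s²b₄², s²b₅²) equals (a₁², a₂², a₃², α·a₄², a₅²) or (a₅², α·a₄², a₃², a₂², a₁²). -/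

import Mathlib

noncomputable section

/-- `x` lies in the image of `ℚ`. -/
def inQ {L : Type*} [DivisionRing L] [CharZero L] (x : L) : Prop :=
  ∃ q : ℚ, (q : L) = x

/-- `cond_A(K)`: every `K`-point of `E₁`, `E₁⁻¹`, `E₄`, `E₆`, `E₆⁻¹` is rational. -/
def condA (K : Type*) [Field K] [CharZero K] : Prop :=
  (∀ x y : K, y ^ 2 = x ^ 3 - x ^ 2 + x → inQ x ∧ inQ y) ∧
  (∀ x y : K, y ^ 2 = x ^ 3 + x ^ 2 + x → inQ x ∧ inQ y) ∧
  (∀ x y : K, y ^ 2 = x ^ 3 - x ^ 2 - 64 * x + 220 → inQ x ∧ inQ y) ∧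
  (∀ x y : K, y ^ 2 = x ^ 3 - x ^ 2 - 4 * x + 4 → inQ x ∧ inQ y) ∧
  (∀ x y : K, y ^ 2 = x ^ 3 + x ^ 2 - 4 * x - 4 → inQ x ∧ inQ y)

/-- `cond_B(K)`: `E₁(K)` and `E₁⁻¹(K)` are finite (rank `0`), and `[K:ℚ] < 8` or `[K:ℚ]` odd. -/
def condB (K : Type*) [Field K] [CharZero K] : Prop :=
  {p : K × K | p.2 ^ 2 = p.1 ^ 3 - p.1 ^ 2 + p.1}.Finite ∧
  {p : K × K | p.2 ^ 2 = p.1 ^ 3 + p.1 ^ 2 + p.1}.Finite ∧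
  (Module.finrank ℚ K < 8 ∨ Odd (Module.finrank ℚ K))

theorem four_num (x y a b : ℤ) (hx : x ≠ 0) (h : x * y = a * b) :
    ∃ α β γ δ : ℤ, x = α * β ∧ a = α * γ ∧ y = γ * δ ∧ b = β * δ ∧ IsCoprime β γ := by
  have hg : 0 < Int.gcd x a := Int.gcd_pos_of_ne_zero_left _ hx
  obtain ⟨β, γ, hc, h1, h2⟩ := Int.exists_gcd_one hg
  set g : ℤ := (Int.gcd x a : ℤ) with hgdef
  have hg0 : g ≠ 0 := by simp [hgdef]; tauto
  have hco : IsCoprime β γ := Int.isCoprime_iff_gcd_eq_one.mpr hc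
  have h3 : β * y = γ * b := by
    apply mul_left_cancel₀ hg0
    calc g * (β * y) = x * y := by rw [h1]; ring
      _ = a * b := h
      _ = g * (γ * b) := by rw [h2]; ring
  have h4 : γ ∣ y := hco.symm.dvd_of_dvd_mul_left (Dvd.intro b h3.symm)
  obtain ⟨δ, hδ⟩ := h4
  have hγ_or : γ ≠ 0 ∨ γ = 0 := by tauto
  rcases hγ_or with hγ | hγ
  · refine ⟨g, β, γ, δ, by rw [h1]; ring, by rw [h2]; ring, hδ, ?_, hco⟩
    apply mul_left_cancel₀ hγ
    rw [← h3, hδ]; ring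
  · subst hγ
    have hβ : IsUnit β := isCoprime_zero_right.mp hco
    rcases Int.isUnit_iff.mp hβ with hβ | hβ
    · refine ⟨g, β, 0, b, by rw [h1]; ring, by rw [h2]; ring, by simp [hδ], by simp [hβ], hco⟩
    · refine ⟨g, β, 0, -b, by rw [h1]; ring, by rw [h2]; ring, by simp [hδ], by simp [hβ], hco⟩

theorem dvd_three {k β γ u v : ℤ} (hco : IsCoprime β γ) (h1 : 3 * β ^ 2 = k * u)
    (h2 : 3 * γ ^ 2 = k * v) : k = 1 ∨ k = -1 ∨ k = 3 ∨ k = -3 := by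
  have hd : k ∣ 3 := by
    obtain ⟨p, q, hpq⟩ := (hco.pow (m := 2) (n := 2))
    exact ⟨p * u + q * v, by linear_combination (-3) * hpq + p * h1 + q * h2⟩
  have hp : Prime (3 : ℤ) := Int.prime_three
  have h3 : k.natAbs ∣ 3 := by simpa using Int.natAbs_dvd_natAbs.mpr hd
  have := (Nat.dvd_prime Nat.prime_three).mp h3
  omega

theorem pyth {x y z : ℤ} (h : x ^ 2 + y ^ 2 = z ^ 2) (hco : IsCoprime x y) (hx : x % 2 = 1)
     : ∃ m n : ℤ, x = m ^ 2 - n ^ 2 ∧ y = 2 * m * n ∧ |z| = m ^ 2 + n ^ 2 ∧ IsCoprime m n ∧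
      ((m % 2 = 0 ∧ n % 2 = 1) ∨ (m % 2 = 1 ∧ n % 2 = 0)) := by
  have hz : z ≠ 0 := by
    rintro rfl
    have : x = 0 := by nlinarith [sq_nonneg x, sq_nonneg y]
    omega
  have ht : PythagoreanTriple x y |z| := by
    unfold PythagoreanTriple
    have := sq_abs z
    nlinarith
  obtain ⟨m, n, h1, h2, h3, h4, h5, _⟩ := PythagoreanTriple.coprime_classification' ht
    (Int.isCoprime_iff_gcd_eq_one.mp hco) hx (abs_pos.mpr hz)
  exact ⟨m, n, h1, h2, h3, Int.isCoprime_iff_gcd_eq_one.mpr h4, h5⟩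

theorem odd_sq_mod {y : ℤ} (h : y % 2 = 1) : y ^ 2 % 8 = 1 := by
  have := Int.sq_mod_four_eq_one_of_odd (Int.odd_iff.mpr h)
  obtain ⟨k, hk⟩ := Int.odd_iff.mpr h
  obtain ⟨l, hl⟩ := Int.even_mul_succ_self k
  have : y ^ 2 = 8 * l + 1 := by rw [hk]; linear_combination 4 * hl
  omega

/-- descent for the first system, normalised so that `x` is even -/
theorem star_step (x y a b : ℤ) (hxy : IsCoprime (2 * x) y) (hab : IsCoprime a b)
    (h1 : x * y = a * b) (h2 : (2 * x) ^ 2 - y ^ 2 = a ^ 2 - b ^ 2) (h0 : a * b ≠ 0) :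
    ∃ r s p q : ℤ, IsCoprime r s ∧ IsCoprime p q ∧ r * s = 2 * (p * q) ∧
      r ^ 2 - s ^ 2 = p ^ 2 - q ^ 2 ∧ p * q ≠ 0 ∧ (p * q).natAbs < (a * b).natAbs := by
  have hx : x ≠ 0 := by
    rintro rfl
    exact h0 (by rw [← h1]; ring)
  obtain ⟨α, β, γ, δ, rfl, rfl, rfl, rfl, hco⟩ := four_num x y a b hx h1
  have hα : α ≠ 0 := by rintro rfl; simp at h0
  have hβ : β ≠ 0 := by rintro rfl; simp at h0
  have hγ : γ ≠ 0 := by rintro rfl; simp at h0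
  have hδ : δ ≠ 0 := by rintro rfl; simp at h0
  have hαδ : IsCoprime α δ := by
    have : IsCoprime (2 * (α * β)) (γ * δ) := hxy
    exact (this.of_mul_left_right.of_mul_left_left).of_mul_right_right
  have hyodd : (γ * δ) % 2 = 1 := by
    have : IsCoprime (2 : ℤ) (γ * δ) := hxy.of_mul_left_left
    rcases Int.emod_two_eq_zero_or_one (γ * δ) with h | h
    · have h' := this.isUnit_of_dvd' (dvd_refl 2) (Int.dvd_of_emod_eq_zero h)
      norm_num [Int.isUnit_iff] at h'
    · exact h
  have hγo : γ % 2 = 1 := by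
    have := Int.odd_mul.mp (Int.odd_iff.mpr hyodd); exact Int.odd_iff.mp this.1
  have hδo : δ % 2 = 1 := by
    have := Int.odd_mul.mp (Int.odd_iff.mpr hyodd); exact Int.odd_iff.mp this.2
  have e1 : α ^ 2 * (4 * β ^ 2 - γ ^ 2) = δ ^ 2 * (γ ^ 2 - β ^ 2) := by linear_combination h2
  have hd : δ ^ 2 ∣ 4 * β ^ 2 - γ ^ 2 :=
    (hαδ.symm.pow (m := 2) (n := 2)).dvd_of_dvd_mul_left (Dvd.intro _ e1.symm)
  obtain ⟨k, hk⟩ := hd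
  have hk2 : γ ^ 2 - β ^ 2 = α ^ 2 * k := by
    apply mul_left_cancel₀ (pow_ne_zero 2 hδ)
    rw [← e1, hk]; ring
  have f1 : 3 * β ^ 2 = k * (α ^ 2 + δ ^ 2) := by linear_combination hk + hk2
  have f2 : 3 * γ ^ 2 = k * (4 * α ^ 2 + δ ^ 2) := by linear_combination hk + 4 * hk2
  have hkpos : 0 < k := by
    have : 0 < 3 * β ^ 2 := by positivity
    have h' : 0 < α ^ 2 + δ ^ 2 := by positivity
    rw [f1] at this
    by_contra hk0
    have := mul_nonneg (by linarith : 0 ≤ -k) h'.le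
    linarith
  have o1 := odd_sq_mod hγo
  have o2 := odd_sq_mod hδo
  rcases dvd_three hco f1 f2 with rfl | rfl | rfl | rfl
  · omega
  · omega
  · have g1 : δ ^ 2 + α ^ 2 = β ^ 2 := by linarith
    have g2 : δ ^ 2 + (2 * α) ^ 2 = γ ^ 2 := by linarith
    have hδ2 : IsCoprime δ (2 * α) := by
      refine IsCoprime.mul_right ?_ hαδ.symm
      exact (hxy.of_mul_left_left.of_mul_right_right).symm
    obtain ⟨p, q, p1, p2, -, p4, -⟩ := pyth g1 hαδ.symm hδo
    obtain ⟨r, s, r1, r2, -, r4, -⟩ := pyth g2 hδ2 hδo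
    have hpq : p * q ≠ 0 := by
      intro h; apply hα; rw [p2]; linear_combination 2 * h
    refine ⟨r, s, p, q, r4, p4, by linarith, by linarith, hpq, ?_⟩
    have : α * γ * (β * δ) = p * q * (2 * (γ * (β * δ))) := by rw [p2]; ring
    rw [this, Int.natAbs_mul (p * q)]
    have t1 : 0 < (p * q).natAbs := Int.natAbs_pos.mpr hpq
    have t2 : 0 < (γ * (β * δ)).natAbs := Int.natAbs_pos.mpr (by positivity)
    rw [Int.natAbs_mul 2]
    have t3 : (2 : ℤ).natAbs = 2 := rfl
    rw [t3]
    nlinarith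
  · omega

theorem star (N : ℕ) : ∀ (x y a b : ℤ), (a * b).natAbs = N → IsCoprime x y → IsCoprime a b →
    x * y = 2 * (a * b) → x ^ 2 - y ^ 2 = a ^ 2 - b ^ 2 → a * b = 0 := by
  induction N using Nat.strong_induction_on with
  | _ N ih =>
    intro x y a b hN hxy hab h1 h2
    by_contra h0
    have key : ∃ r s p q : ℤ, IsCoprime r s ∧ IsCoprime p q ∧ r * s = 2 * (p * q) ∧
      r ^ 2 - s ^ 2 = p ^ 2 - q ^ 2 ∧ p * q ≠ 0 ∧ (p * q).natAbs < (a * b).natAbs := by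
      have he : Even (x * y) := by rw [h1]; exact even_two_mul _
      rcases Int.even_mul.mp he with hx | hy
      · obtain ⟨x', rfl⟩ := hx.two_dvd
        exact star_step x' y a b hxy hab (by linarith) h2 h0
      · obtain ⟨y', rfl⟩ := hy.two_dvd
        have := star_step y' x b a hxy.symm hab.symm (by linarith) (by linarith) (by rwa [mul_comm])
        rwa [mul_comm b a] at this
    obtain ⟨r, s, p, q, k1, k2, k3, k4, k5, k6⟩ := key
    exact k5 (ih _ (hN ▸ k6) r s p q rfl k1 k2 k3 k4)

theorem star'_step (x y a b : ℤ) (hxy : IsCoprime (2 * x) y) (hab : IsCoprime a b)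
    (h1 : x * y = a * b) (h2 : (2 * x) ^ 2 + y ^ 2 = a ^ 2 + b ^ 2) (h0 : a * b ≠ 0) :
    ∃ r s p q : ℤ, IsCoprime r s ∧ IsCoprime p q ∧ r * s = 2 * (p * q) ∧
      r ^ 2 + s ^ 2 = p ^ 2 + q ^ 2 ∧ p * q ≠ 0 ∧ (p * q).natAbs < (a * b).natAbs := by
  have hx : x ≠ 0 := by
    rintro rfl
    exact h0 (by rw [← h1]; ring)
  obtain ⟨α, β, γ, δ, rfl, rfl, rfl, rfl, hco⟩ := four_num x y a b hx h1
  have hα : α ≠ 0 := by rintro rfl; simp at h0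
  have hβ : β ≠ 0 := by rintro rfl; simp at h0
  have hγ : γ ≠ 0 := by rintro rfl; simp at h0
  have hδ : δ ≠ 0 := by rintro rfl; simp at h0
  have hαδ : IsCoprime α δ :=
    (hxy.of_mul_left_right.of_mul_left_left).of_mul_right_right
  have hαβ : IsCoprime α β := hab.of_mul_left_left.of_mul_right_left
  have hyodd : (γ * δ) % 2 = 1 := by
    have : IsCoprime (2 : ℤ) (γ * δ) := hxy.of_mul_left_left
    rcases Int.emod_two_eq_zero_or_one (γ * δ) with h | h
    · have h' := this.isUnit_of_dvd' (dvd_refl 2) (Int.dvd_of_emod_eq_zero h)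
      norm_num [Int.isUnit_iff] at h'
    · exact h
  have hγo : γ % 2 = 1 := by
    have := Int.odd_mul.mp (Int.odd_iff.mpr hyodd); exact Int.odd_iff.mp this.1
  have hδo : δ % 2 = 1 := by
    have := Int.odd_mul.mp (Int.odd_iff.mpr hyodd); exact Int.odd_iff.mp this.2
  have h2γ : IsCoprime γ 2 := (hxy.of_mul_left_left.of_mul_right_left).symm
  have h2δ : IsCoprime δ 2 := (hxy.of_mul_left_left.of_mul_right_right).symm
  have e1 : α ^ 2 * (4 * β ^ 2 - γ ^ 2) = δ ^ 2 * (β ^ 2 - γ ^ 2) := by linear_combination h2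
  have hd : δ ^ 2 ∣ 4 * β ^ 2 - γ ^ 2 :=
    (hαδ.symm.pow (m := 2) (n := 2)).dvd_of_dvd_mul_left (Dvd.intro _ e1.symm)
  obtain ⟨k, hk⟩ := hd
  have hk2 : β ^ 2 - γ ^ 2 = α ^ 2 * k := by
    apply mul_left_cancel₀ (pow_ne_zero 2 hδ)
    rw [← e1, hk]; ring
  have f1 : 3 * β ^ 2 = k * (δ ^ 2 - α ^ 2) := by linear_combination hk - hk2
  have f2 : 3 * γ ^ 2 = k * (δ ^ 2 - 4 * α ^ 2) := by linear_combination hk - 4 * hk2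
  have o1 := odd_sq_mod hγo
  have o2 := odd_sq_mod hδo
  have fin : ∀ (u v : ℤ), u ≠ 0 → v ≠ 0 → α * γ * (β * δ) = u * v → ∀ p q : ℤ, u = 2 * p * q →
      p * q ≠ 0 ∧ (p * q).natAbs < (α * γ * (β * δ)).natAbs := by
    intro u v hu hv huv p q hpq
    have hpq0 : p * q ≠ 0 := by
      intro h; apply hu; rw [hpq]; linear_combination 2 * h
    refine ⟨hpq0, ?_⟩
    have : α * γ * (β * δ) = p * q * (2 * v) := by rw [huv, hpq]; ring
    rw [this, Int.natAbs_mul (p * q)]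
    have t1 : 0 < (p * q).natAbs := Int.natAbs_pos.mpr hpq0
    have t2 : 0 < v.natAbs := Int.natAbs_pos.mpr hv
    rw [Int.natAbs_mul 2]
    have t3 : (2 : ℤ).natAbs = 2 := rfl
    rw [t3]
    nlinarith
  rcases dvd_three hco f1 f2 with rfl | rfl | rfl | rfl
  · omega
  · -- k = -1
    have g1 : α ^ 2 + β ^ 2 = γ ^ 2 := by linarith
    have g2 : δ ^ 2 + (2 * β) ^ 2 = γ ^ 2 := by linarith
    have c2 : IsCoprime δ (2 * β) := by
      refine IsCoprime.mul_right h2δ ?_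
      have : IsCoprime (δ ^ 2) β := by
        have e : δ ^ 2 = γ ^ 2 + β * (-4 * β) := by linear_combination g2
        rw [e]
        exact (hco.symm.pow_left).add_mul_left_left _
      exact (IsCoprime.pow_left_iff (by norm_num)).mp this
    obtain ⟨r, s, r1, r2, r3, r4, r5⟩ := pyth g2 c2 hδo
    have hβ' : β = r * s := by linarith
    have hβe : β % 2 = 0 := by
      rw [hβ', Int.mul_emod]
      rcases r5 with ⟨h, h'⟩ | ⟨h, h'⟩ <;> rw [h, h'] <;> rfl
    have hαo : α % 2 = 1 := by
      rcases Int.emod_two_eq_zero_or_one α with h | h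
      · exfalso
        have := hαβ.isUnit_of_dvd' (Int.dvd_of_emod_eq_zero h) (Int.dvd_of_emod_eq_zero hβe)
        norm_num [Int.isUnit_iff] at this
      · exact h
    obtain ⟨p, q, p1, p2, p3, p4, -⟩ := pyth g1 hαβ hαo
    obtain ⟨w1, w2⟩ := fin β (α * γ * δ) hβ (by positivity) (by ring) p q p2
    exact ⟨r, s, p, q, r4, p4, by linarith, by linarith, w1, w2⟩
  · -- k = 3
    have g1 : β ^ 2 + α ^ 2 = δ ^ 2 := by linarith
    have g2 : γ ^ 2 + (2 * α) ^ 2 = δ ^ 2 := by linarith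
    have c2 : IsCoprime γ (2 * α) := by
      refine IsCoprime.mul_right h2γ ?_
      have : IsCoprime (γ ^ 2) α := by
        have e : γ ^ 2 = δ ^ 2 + α * (-4 * α) := by linear_combination g2
        rw [e]
        exact (hαδ.symm.pow_left).add_mul_left_left _
      exact (IsCoprime.pow_left_iff (by norm_num)).mp this
    obtain ⟨r, s, r1, r2, r3, r4, r5⟩ := pyth g2 c2 hγo
    have hα' : α = r * s := by linarith
    have hαe : α % 2 = 0 := by
      rw [hα', Int.mul_emod]
      rcases r5 with ⟨h, h'⟩ | ⟨h, h'⟩ <;> rw [h, h'] <;> rfl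
    have hβo : β % 2 = 1 := by
      rcases Int.emod_two_eq_zero_or_one β with h | h
      · exfalso
        have := hαβ.isUnit_of_dvd' (Int.dvd_of_emod_eq_zero hαe) (Int.dvd_of_emod_eq_zero h)
        norm_num [Int.isUnit_iff] at this
      · exact h
    obtain ⟨p, q, p1, p2, p3, p4, -⟩ := pyth g1 hαβ.symm hβo
    obtain ⟨w1, w2⟩ := fin α (γ * (β * δ)) hα (by positivity) (by ring) p q p2
    exact ⟨r, s, p, q, r4, p4, by linarith, by linarith, w1, w2⟩
  · omega

theorem star' (N : ℕ) : ∀ (x y a b : ℤ), (a * b).natAbs = N → IsCoprime x y → IsCoprime a b →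
    x * y = 2 * (a * b) → x ^ 2 + y ^ 2 = a ^ 2 + b ^ 2 → a * b = 0 := by
  induction N using Nat.strong_induction_on with
  | _ N ih =>
    intro x y a b hN hxy hab h1 h2
    by_contra h0
    have key : ∃ r s p q : ℤ, IsCoprime r s ∧ IsCoprime p q ∧ r * s = 2 * (p * q) ∧
      r ^ 2 + s ^ 2 = p ^ 2 + q ^ 2 ∧ p * q ≠ 0 ∧ (p * q).natAbs < (a * b).natAbs := by
      have he : Even (x * y) := by rw [h1]; exact even_two_mul _
      rcases Int.even_mul.mp he with hx | hy
      · obtain ⟨x', rfl⟩ := hx.two_dvd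
        exact star'_step x' y a b hxy hab (by linarith) h2 h0
      · obtain ⟨y', rfl⟩ := hy.two_dvd
        have := star'_step y' x b a hxy.symm hab.symm (by linarith) (by linarith) (by rwa [mul_comm])
        rwa [mul_comm b a] at this
    obtain ⟨r, s, p, q, k1, k2, k3, k4, k5, k6⟩ := key
    exact k5 (ih _ (hN ▸ k6) r s p q rfl k1 k2 k3 k4)

theorem sq_mul_of_coprime {a b c : ℤ} (h : IsCoprime a b) (ha : 0 < a) (hb : 0 < b)
    (heq : a * b = c ^ 2) : ∃ p q : ℤ, a = p ^ 2 ∧ b = q ^ 2 := by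
  obtain ⟨p, hp⟩ := Int.sq_of_isCoprime h heq
  obtain ⟨q, hq⟩ := Int.sq_of_isCoprime h.symm (by rw [mul_comm]; exact heq)
  refine ⟨p, q, ?_, ?_⟩
  · rcases hp with hp | hp
    · exact hp
    · nlinarith [sq_nonneg p]
  · rcases hq with hp | hp
    · exact hp
    · nlinarith [sq_nonneg q]

theorem quartic_one_odd {k e z : ℤ} (hco : IsCoprime k e) (hpar : (k ^ 2 - e ^ 2) % 2 = 1)
    (h : k ^ 4 - k ^ 2 * e ^ 2 + e ^ 4 = z ^ 2) : k * e = 0 := by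
  have c1 : IsCoprime (k ^ 2 - e ^ 2) k := by
    have : IsCoprime (e ^ 2) k := hco.symm.pow_left
    have := this.neg_left.add_mul_left_left k
    rwa [show -e ^ 2 + k * k = k ^ 2 - e ^ 2 by ring] at this
  have c2 : IsCoprime (k ^ 2 - e ^ 2) e := by
    have : IsCoprime (k ^ 2) e := hco.pow_left
    have := this.add_mul_left_left (-e)
    rwa [show k ^ 2 + e * -e = k ^ 2 - e ^ 2 by ring] at this
  obtain ⟨a, b, h1, h2, -, h4, -⟩ := pyth (x := k ^ 2 - e ^ 2) (y := k * e) (z := z)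
    (by linear_combination h) (c1.mul_right c2) hpar
  have := star _ k e a b rfl hco h4 (by linarith) h1
  rw [h2]; linear_combination 2 * this

theorem quartic_one {k e z : ℤ} (hco : IsCoprime k e)
    (h : k ^ 4 - k ^ 2 * e ^ 2 + e ^ 4 = z ^ 2) : k * e = 0 ∨ k ^ 2 = e ^ 2 := by
  rcases Int.emod_two_eq_zero_or_one (k ^ 2 - e ^ 2) with hp | hp
  swap
  · exact Or.inl (quartic_one_odd hco hp h)
  have hne : ¬ (k % 2 = 0 ∧ e % 2 = 0) := by
    rintro ⟨hk, he⟩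
    have := hco.isUnit_of_dvd' (Int.dvd_of_emod_eq_zero hk) (Int.dvd_of_emod_eq_zero he)
    norm_num [Int.isUnit_iff] at this
  have hpar : k % 2 = 1 ∧ e % 2 = 1 := by
    rcases Int.emod_two_eq_zero_or_one k with hk | hk <;>
    rcases Int.emod_two_eq_zero_or_one e with he | he <;>
    simp [pow_two, Int.sub_emod, Int.mul_emod, hk, he] at hp hne ⊢
  obtain ⟨u, hu⟩ : ∃ u, k + e = 2 * u := ⟨(k + e) / 2, by omega⟩
  obtain ⟨v, hv⟩ : ∃ v, k - e = 2 * v := ⟨(k - e) / 2, by omega⟩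
  obtain rfl : k = u + v := by linarith
  obtain rfl : e = u - v := by linarith
  have huv : IsCoprime u v := by
    obtain ⟨a, b, hab⟩ := hco
    exact ⟨a + b, a - b, by linear_combination hab⟩
  have h3 : (u ^ 2 - v ^ 2) ^ 2 + (4 * (u * v)) ^ 2 = z ^ 2 := by linear_combination h
  have ho : (u ^ 2 - v ^ 2) % 2 = 1 := by
    have : u ^ 2 - v ^ 2 = (u + v) * (u - v) := by ring
    rw [this, Int.mul_emod, hpar.1, hpar.2]; rfl
  have c1 : IsCoprime (u ^ 2 - v ^ 2) u := by
    have : IsCoprime (v ^ 2) u := huv.symm.pow_left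
    have := this.neg_left.add_mul_left_left u
    rwa [show -v ^ 2 + u * u = u ^ 2 - v ^ 2 by ring] at this
  have c2 : IsCoprime (u ^ 2 - v ^ 2) v := by
    have : IsCoprime (u ^ 2) v := huv.pow_left
    have := this.add_mul_left_left (-v)
    rwa [show u ^ 2 + v * -v = u ^ 2 - v ^ 2 by ring] at this
  have c3 : IsCoprime (u ^ 2 - v ^ 2) 4 := by
    have : IsCoprime (u ^ 2 - v ^ 2) 2 := by
      refine ⟨1, -((u ^ 2 - v ^ 2) / 2), ?_⟩
      omega
    have := this.pow_right (n := 2)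
    norm_num at this
    exact this
  obtain ⟨p, q, h1, h2, -, h4, -⟩ := pyth h3 (c3.mul_right (c1.mul_right c2)) ho
  have := star _ p q u v rfl h4 huv (by linarith) h1.symm
  right
  linear_combination 4 * this

theorem quartic_two {k e z : ℤ} (hco : IsCoprime k e)
    (h : k ^ 4 + k ^ 2 * e ^ 2 + e ^ 4 = z ^ 2) : k * e = 0 := by
  by_contra h0
  have hk : k ≠ 0 := left_ne_zero_of_mul h0
  have he : e ≠ 0 := right_ne_zero_of_mul h0
  have hk2 : 0 < k ^ 2 := by positivity
  have he2 : 0 < e ^ 2 := by positivity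
  have h1 : (k ^ 2 + k * e + e ^ 2) * (k ^ 2 - k * e + e ^ 2) = z ^ 2 := by linear_combination h
  have p1 : 0 < k ^ 2 + k * e + e ^ 2 := by nlinarith [sq_nonneg (k + e)]
  have p2 : 0 < k ^ 2 - k * e + e ^ 2 := by nlinarith [sq_nonneg (k - e)]
  have hodd : (k ^ 2 + k * e + e ^ 2) % 2 = 1 := by
    have hne : ¬ (k % 2 = 0 ∧ e % 2 = 0) := by
      rintro ⟨hk, he⟩
      have := hco.isUnit_of_dvd' (Int.dvd_of_emod_eq_zero hk) (Int.dvd_of_emod_eq_zero he)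
      norm_num [Int.isUnit_iff] at this
    rcases Int.emod_two_eq_zero_or_one k with hk | hk <;>
    rcases Int.emod_two_eq_zero_or_one e with he | he <;>
    simp [pow_two, Int.add_emod, Int.mul_emod, hk, he] at hne ⊢
  have hc : IsCoprime (k ^ 2 + k * e + e ^ 2) (k ^ 2 - k * e + e ^ 2) := by
    have c1 : IsCoprime (k ^ 2 + k * e + e ^ 2) k := by
      have : IsCoprime (e ^ 2) k := hco.symm.pow_left
      have := this.add_mul_left_left (k + e)
      rwa [show e ^ 2 + k * (k + e) = k ^ 2 + k * e + e ^ 2 by ring] at this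
    have c2 : IsCoprime (k ^ 2 + k * e + e ^ 2) e := by
      have : IsCoprime (k ^ 2) e := hco.pow_left
      have := this.add_mul_left_left (k + e)
      rwa [show k ^ 2 + e * (k + e) = k ^ 2 + k * e + e ^ 2 by ring] at this
    have c3 : IsCoprime (k ^ 2 + k * e + e ^ 2) 2 :=
      ⟨1, -((k ^ 2 + k * e + e ^ 2) / 2), by omega⟩
    have c4 := (c3.mul_right (c1.mul_right c2)).neg_right.add_mul_left_right 1
    rwa [show -(2 * (k * e)) + (k ^ 2 + k * e + e ^ 2) * 1 = k ^ 2 - k * e + e ^ 2 by ring] at c4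
  obtain ⟨p, q, hp, hq⟩ := sq_mul_of_coprime hc p1 p2 h1
  have po : p % 2 = 1 := by
    rcases Int.emod_two_eq_zero_or_one p with h | h
    · rw [hp, pow_two, Int.mul_emod, h] at hodd; simp at hodd
    · exact h
  have qo : q % 2 = 1 := by
    have : (k ^ 2 - k * e + e ^ 2) % 2 = 1 := by omega
    rcases Int.emod_two_eq_zero_or_one q with h | h
    · rw [hq, pow_two, Int.mul_emod, h] at this; simp at this
    · exact h
  obtain ⟨r, hr⟩ : ∃ r, p + q = 2 * r := ⟨(p + q) / 2, by omega⟩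
  obtain ⟨s, hs⟩ : ∃ s, p - q = 2 * s := ⟨(p - q) / 2, by omega⟩
  obtain rfl : p = r + s := by linarith
  obtain rfl : q = r - s := by linarith
  have hpq : IsCoprime (r + s) (r - s) := by
    rw [hp, hq] at hc
    exact (IsCoprime.pow_iff (by norm_num) (by norm_num)).mp hc
  have hrs : IsCoprime r s := by
    obtain ⟨a, b, hab⟩ := hpq
    exact ⟨a + b, a - b, by linear_combination hab⟩
  have := star' _ k e r s rfl hco hrs (by linarith) (by linarith)
  exact h0 (by linarith)

theorem rat_num_den (x : ℚ) : ∃ p q : ℤ, 0 < q ∧ IsCoprime p q ∧ x = p / q :=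
  ⟨x.num, x.den, by exact_mod_cast x.den_pos, Rat.isCoprime_num_den x, (Rat.num_div_den x).symm⟩

theorem int_of_rat_sq {n : ℤ} {t : ℚ} (h : t ^ 2 = n) : ∃ m : ℤ, n = m ^ 2 := by
  have : IsSquare (n : ℚ) := ⟨t, by rw [← h]; ring⟩
  obtain ⟨m, hm⟩ := Rat.isSquare_intCast_iff.mp this
  exact ⟨m, by rw [hm]; ring⟩

theorem E1_rat {x y : ℚ} (h : y ^ 2 = x ^ 3 - x ^ 2 + x) : x = 0 ∨ x = 1 := by
  obtain ⟨p, q, hq, hc, rfl⟩ := rat_num_den x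
  have hq' : (q : ℚ) ≠ 0 := by exact_mod_cast hq.ne'
  have e1 : (y * q ^ 2) ^ 2 = ((p * q * (p ^ 2 - p * q + q ^ 2) : ℤ) : ℚ) := by
    rw [mul_pow, h]; push_cast; field_simp
  obtain ⟨m, hm⟩ := int_of_rat_sq e1
  by_cases hp0 : p = 0
  · left; simp [hp0]
  right
  have hpos : 0 < p ^ 2 - p * q + q ^ 2 := by
    have : 0 < p ^ 2 := by positivity
    nlinarith [sq_nonneg (p - q), sq_nonneg q]
  have hp : 0 < p := by
    by_contra hp
    have : p < 0 := by omega
    have := mul_pos (mul_pos (neg_pos.mpr this) hq) hpos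
    nlinarith [sq_nonneg m]
  have c1 : IsCoprime p (p ^ 2 - p * q + q ^ 2) := by
    have := (hc.pow_right (n := 2)).add_mul_left_right (p - q)
    rwa [show q ^ 2 + p * (p - q) = p ^ 2 - p * q + q ^ 2 by ring] at this
  have c2 : IsCoprime q (p ^ 2 - p * q + q ^ 2) := by
    have := (hc.symm.pow_right (n := 2)).add_mul_left_right (q - p)
    rwa [show p ^ 2 + q * (q - p) = p ^ 2 - p * q + q ^ 2 by ring] at this
  obtain ⟨a, b, ha, hb⟩ := sq_mul_of_coprime (c1.mul_left c2) (mul_pos hp hq) hpos hm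
  obtain ⟨c, d, rfl, rfl⟩ := sq_mul_of_coprime hc hp hq ha
  have hcd : IsCoprime c d := (IsCoprime.pow_iff (by norm_num) (by norm_num)).mp hc
  rcases quartic_one (z := b) hcd (by linarith) with h | h
  · rcases mul_eq_zero.mp h with h | h <;> simp [h] at hp hq
  · rw [h]; field_simp

theorem E1m_rat {x y : ℚ} (h : y ^ 2 = x ^ 3 + x ^ 2 + x) : x = 0 := by
  obtain ⟨p, q, hq, hc, rfl⟩ := rat_num_den x
  have hq' : (q : ℚ) ≠ 0 := by exact_mod_cast hq.ne'
  have e1 : (y * q ^ 2) ^ 2 = ((p * q * (p ^ 2 + p * q + q ^ 2) : ℤ) : ℚ) := by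
    rw [mul_pow, h]; push_cast; field_simp
  obtain ⟨m, hm⟩ := int_of_rat_sq e1
  by_cases hp0 : p = 0
  · simp [hp0]
  exfalso
  have hpos : 0 < p ^ 2 + p * q + q ^ 2 := by
    have : 0 < p ^ 2 := by positivity
    nlinarith [sq_nonneg (p + q), sq_nonneg q]
  have hp : 0 < p := by
    by_contra hp
    have : p < 0 := by omega
    have := mul_pos (mul_pos (neg_pos.mpr this) hq) hpos
    nlinarith [sq_nonneg m]
  have c1 : IsCoprime p (p ^ 2 + p * q + q ^ 2) := by
    have := (hc.pow_right (n := 2)).add_mul_left_right (p + q)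
    rwa [show q ^ 2 + p * (p + q) = p ^ 2 + p * q + q ^ 2 by ring] at this
  have c2 : IsCoprime q (p ^ 2 + p * q + q ^ 2) := by
    have := (hc.symm.pow_right (n := 2)).add_mul_left_right (q + p)
    rwa [show p ^ 2 + q * (q + p) = p ^ 2 + p * q + q ^ 2 by ring] at this
  obtain ⟨a, b, ha, hb⟩ := sq_mul_of_coprime (c1.mul_left c2) (mul_pos hp hq) hpos hm
  obtain ⟨c, d, rfl, rfl⟩ := sq_mul_of_coprime hc hp hq ha
  have hcd : IsCoprime c d := (IsCoprime.pow_iff (by norm_num) (by norm_num)).mp hc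
  have h := quartic_two (z := b) hcd (by linarith)
  rcases mul_eq_zero.mp h with h | h <;> simp [h] at hp hq

/-- the 2-isogeny from `X (X + ε) (X + 4 ε) = Y ^ 2` to `E₁` or its twist -/
theorem isog {F : Type*} [Field F] [CharZero F] {ε X Y : F} (he : ε ^ 2 = 1) (hX : X + ε ≠ 0)
    (h : Y ^ 2 = X * (X + ε) * (X + 4 * ε)) :
    (-Y * (3 + (X + ε) ^ 2) / (8 * (X + ε) ^ 2)) ^ 2 =
      (((X + ε) ^ 2 + 2 * ε * (X + ε) - 3) / (4 * (X + ε))) ^ 3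
      - ε * (((X + ε) ^ 2 + 2 * ε * (X + ε) - 3) / (4 * (X + ε))) ^ 2
      + (((X + ε) ^ 2 + 2 * ε * (X + ε) - 3) / (4 * (X + ε))) := by
  obtain ⟨x, rfl⟩ : ∃ x, X = x - ε := ⟨X + ε, by ring⟩
  simp only [sub_add_cancel] at hX ⊢
  have h' : Y ^ 2 = x * (x ^ 2 + 2 * ε * x - 3) := by
    rw [h]; linear_combination (-3) * x * he
  rw [div_pow, mul_pow, neg_sq, h']
  have he' : ε = 1 ∨ ε = -1 := mul_self_eq_one_iff.mp (by rw [← he]; ring)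
  rcases he' with rfl | rfl <;> field_simp <;> ring

theorem E6_rat {X Y : ℚ} (h : Y ^ 2 = X * (X + 1) * (X + 4)) :
    X = 0 ∨ X = -1 ∨ X = -4 ∨ X = 2 ∨ X = -2 := by
  by_cases hX : X + 1 = 0
  · right; left; linarith
  have := isog (ε := 1) (by norm_num) hX (by rw [h]; ring)
  rw [one_mul] at this
  rcases E1_rat this with h1 | h1
  · rw [div_eq_zero_iff] at h1
    have h2 : X * (X + 4) = 0 := by
      rcases h1 with h1 | h1
      · linear_combination h1
      · exfalso; apply hX; linarith
    rcases mul_eq_zero.mp h2 with h2 | h2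
    · left; exact h2
    · right; right; left; linarith
  · rw [div_eq_one_iff_eq (by simpa using hX)] at h1
    have h2 : (X - 2) * (X + 2) = 0 := by linear_combination h1
    rcases mul_eq_zero.mp h2 with h2 | h2
    · right; right; right; left; linarith
    · right; right; right; right; linarith

theorem E6m_rat {X Y : ℚ} (h : Y ^ 2 = X * (X - 1) * (X - 4)) :
    X = 0 ∨ X = 1 ∨ X = 4 := by
  by_cases hX : X + (-1) = 0
  · right; left; linarith
  have := isog (ε := -1) (by norm_num) hX (by rw [h]; ring)
  rw [neg_one_mul, sub_neg_eq_add] at this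
  have h1 := E1m_rat this
  rw [div_eq_zero_iff] at h1
  have h2 : X * (X - 4) = 0 := by
    rcases h1 with h1 | h1
    · linear_combination h1
    · exfalso; apply hX; linarith
  rcases mul_eq_zero.mp h2 with h2 | h2
  · left; exact h2
  · right; right; linarith

structure OrdFun {K : Type*} [Field K] (o : K → ℤ) : Prop where
  mul : ∀ x y, x ≠ 0 → y ≠ 0 → o (x * y) = o x + o y
  add : ∀ x y, x ≠ 0 → y ≠ 0 → x + y ≠ 0 → min (o x) (o y) ≤ o (x + y)
  two : 0 < o 2

open IsDedekindDomain NumberField in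
theorem ordFun_of_prime {K : Type*} [Field K] [NumberField K] (v : HeightOneSpectrum (𝓞 K))
    (h2 : (2 : 𝓞 K) ∈ v.asIdeal) :
    OrdFun (fun x : K => - WithZero.log (v.valuation K x)) where
  mul x y hx hy := by
    rw [map_mul, WithZero.log_mul (by simpa using hx) (by simpa using hy)]; ring
  add x y hx hy hxy := by
    have := (v.valuation K).map_add x y
    have hx' : v.valuation K x ≠ 0 := by simpa using hx
    have hy' : v.valuation K y ≠ 0 := by simpa using hy
    have hxy' : v.valuation K (x + y) ≠ 0 := by simpa using hxy
    rw [le_max_iff, ← WithZero.log_le_log hxy' hx', ← WithZero.log_le_log hxy' hy'] at this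
    omega
  two := by
    have h := (v.valuation_lt_one_iff_mem (K := K) (2 : 𝓞 K)).mpr h2
    have h0 : v.valuation K ((2 : 𝓞 K) : K) ≠ 0 := by
      rw [Valuation.ne_zero_iff]; norm_num
    rw [← WithZero.log_lt_log h0 one_ne_zero] at h
    simp only [WithZero.log_one] at h
    have e : ((2 : 𝓞 K) : K) = 2 := map_ofNat (algebraMap (𝓞 K) K) 2
    rw [e] at h
    omega

open IsDedekindDomain NumberField in
theorem exists_ordFun (K : Type*) [Field K] [NumberField K]
    (hn : Module.finrank ℚ K < 8 ∨ Odd (Module.finrank ℚ K)) :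
    ∃ o : K → ℤ, OrdFun o ∧ ¬ (8 : ℤ) ∣ o 2 := by
  by_contra hcon
  push Not at hcon
  let p : Ideal ℤ := Ideal.span {2}
  have hp0 : p ≠ ⊥ := by simp [p]
  have hpm : p.IsMaximal :=
    PrincipalIdealRing.isMaximal_of_irreducible Int.prime_two.irreducible
  have key := Ideal.sum_ramification_inertia (𝓞 K) ℚ K hp0
  have hdvd : 8 ∣ Module.finrank ℚ K := by
    rw [← key]
    refine Finset.dvd_sum fun P hP => Dvd.dvd.mul_right ?_ _
    obtain ⟨hP1, hP2⟩ := (IsDedekindDomain.mem_primesOverFinset_iff hp0 _).mp hP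
    have hmap : Ideal.map (algebraMap ℤ (𝓞 K)) p = Ideal.span {(2 : 𝓞 K)} := by
      simp [p, Ideal.map_span]
    have hle : Ideal.map (algebraMap ℤ (𝓞 K)) p ≤ P := by
      rw [Ideal.map_le_iff_le_comap, hP2.over]
    have h2P : (2 : 𝓞 K) ∈ P := hle (by rw [hmap]; exact Ideal.mem_span_singleton_self _)
    have hPbot : P ≠ ⊥ := by
      rintro rfl
      simp at h2P
    let v : HeightOneSpectrum (𝓞 K) := ⟨P, hP1, hPbot⟩
    have ho := ordFun_of_prime v h2P
    have h8 := hcon _ ho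
    have hpos := ho.two
    have e : v.valuation K (2 : K) = v.intValuation 2 := by
      rw [← v.valuation_of_algebraMap (K := K) (2 : 𝓞 K)]
      exact congrArg _ (map_ofNat (algebraMap (𝓞 K) K) 2).symm
    rw [e] at h8 hpos
    obtain ⟨n, hn⟩ : ∃ n : ℕ, -WithZero.log (v.intValuation (2 : 𝓞 K)) = n :=
      ⟨_, (Int.toNat_of_nonneg hpos.le).symm⟩
    have hv : v.intValuation (2 : 𝓞 K) = WithZero.exp (-(n : ℤ)) := by
      rw [← hn, neg_neg, WithZero.exp_log (v.intValuation_ne_zero _ two_ne_zero)]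
    have hr : Ideal.ramificationIdx' p P = n := by
      apply Ideal.ramificationIdx'_spec
      · rw [hmap, Ideal.span_singleton_le_iff_mem]
        exact (v.intValuation_le_pow_iff_mem 2 n).mp hv.le
      · rw [hmap, Ideal.span_singleton_le_iff_mem]
        intro h
        have := (v.intValuation_le_pow_iff_mem 2 (n + 1)).mpr h
        rw [hv, WithZero.exp_le_exp] at this
        push_cast at this
        omega
    rw [hr]
    rw [hn] at h8
    exact_mod_cast h8
  have hpos : 0 < Module.finrank ℚ K := Module.finrank_pos
  rcases hn with h | h
  · exact absurd (Nat.le_of_dvd hpos hdvd) (by omega)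
  · rw [Nat.odd_iff] at h; omega

namespace OrdFun
variable {K : Type*} [Field K] [CharZero K] {o : K → ℤ}

theorem one (h : OrdFun o) : o 1 = 0 := by
  have := h.mul 1 1 one_ne_zero one_ne_zero
  rw [mul_one] at this; omega

theorem neg (h : OrdFun o) (x : K) (hx : x ≠ 0) : o (-x) = o x := by
  have h1 := h.mul (-1) (-1) (by norm_num) (by norm_num)
  rw [neg_mul_neg, mul_one, h.one] at h1
  have h2 := h.mul (-1) x (by norm_num) hx
  rw [neg_one_mul] at h2; omega

theorem add_eq (h : OrdFun o) (x y : K) (hx : x ≠ 0) (hy : y ≠ 0) (hxy : x + y ≠ 0)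
    (hlt : o x < o y) : o (x + y) = o x := by
  have h1 := h.add x y hx hy hxy
  have h2 := h.add (x + y) (-y) hxy (neg_ne_zero.mpr hy) (by simpa using hx)
  rw [h.neg y hy, add_neg_cancel_right] at h2
  omega

/-- comparison for `z = x + y` in all forms -/
theorem tri (h : OrdFun o) (x y z : K) (hx : x ≠ 0) (hy : y ≠ 0) (hz : z ≠ 0) (e : z = x + y) :
    min (o x) (o y) ≤ o z ∧ (o x < o y → o z = o x) ∧ (o y < o x → o z = o y) := by
  subst e
  refine ⟨h.add x y hx hy hz, h.add_eq x y hx hy hz, fun hlt => ?_⟩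
  rw [add_comm]
  exact h.add_eq y x hy hx (by rwa [add_comm]) hlt

theorem four (h : OrdFun o) : o 4 = 2 * o 2 := by
  have := h.mul 2 2 two_ne_zero two_ne_zero
  norm_num at this; omega

end OrdFun

/-- duplication on the x-coordinate -/
def dupl {K : Type*} [Field K] (ε x : K) : K :=
  (x ^ 2 - 4) ^ 2 / (4 * (x * (x + ε) * (x + 4 * ε)))

theorem ord_dupl {K : Type*} [Field K] [CharZero K] {o : K → ℤ} (h : OrdFun o) (ε x : K)
    (he : ε ^ 2 = 1) (h1 : x ≠ 0) (h2 : x + ε ≠ 0) (h3 : x + 4 * ε ≠ 0) (h4 : dupl ε x ≠ 0) :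
    (o x < 0 → o (dupl ε x) < o x) ∧ (0 ≤ o x → o x ≠ o 2 → o (dupl ε x) < 0) ∧
    (o x = o 2 → o (dupl ε x) = o 2 →
      o (x + ε) = 0 ∧ o (x + 4 * ε) = o 2 ∧ 4 * o (x - 2) = 5 * o 2 ∧ 4 * o (x + 2) = 5 * o 2) := by
  have hε : ε = 1 ∨ ε = -1 := mul_self_eq_one_iff.mp (by rw [← he]; ring)
  have hε0 : ε ≠ 0 := by rintro rfl; norm_num at he
  have oε : o ε = 0 := by
    rcases hε with rfl | rfl
    · exact h.one
    · rw [h.neg 1 one_ne_zero, h.one]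
  have o4 := h.four
  have o4ε : o (4 * ε) = 2 * o 2 := by rw [h.mul 4 ε (by norm_num) hε0]; omega
  have h22 : (x - 2) * (x + 2) ≠ 0 := by
    intro h0
    apply h4
    unfold dupl
    rw [show x ^ 2 - 4 = (x - 2) * (x + 2) by ring, h0]; simp
  have hm2 := left_ne_zero_of_mul h22
  have hp2 := right_ne_zero_of_mul h22
  have hd : dupl ε x * (2 * 2 * (x * (x + ε) * (x + 4 * ε))) =
      ((x - 2) * (x + 2)) * ((x - 2) * (x + 2)) := by
    unfold dupl; field_simp; ring
  have hd2 := congrArg o hd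
  rw [h.mul _ _ h4 (by simp [h1, h2, h3]), h.mul _ _ (by norm_num) (by simp [h1, h2, h3]),
    h.mul 2 2 two_ne_zero two_ne_zero, h.mul _ _ (mul_ne_zero h1 h2) h3, h.mul _ _ h1 h2,
    h.mul _ _ h22 h22, h.mul _ _ hm2 hp2] at hd2
  have t1 := h.tri x ε (x + ε) h1 hε0 h2 rfl
  have t2 := h.tri x (4 * ε) (x + 4 * ε) h1 (by simp [hε0]) h3 rfl
  have t3 := h.tri x 2 (x + 2) h1 two_ne_zero hp2 rfl
  have t4 := h.tri x (-2) (x - 2) h1 (by norm_num) hm2 (by ring)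
  have t5 := h.tri (x - 2) 4 (x + 2) hm2 (by norm_num) hp2 (by ring)
  rw [h.neg 2 two_ne_zero] at t4
  have := h.two
  rw [oε] at t1
  rw [o4ε] at t2
  rw [o4] at t5
  generalize o x = m at *
  generalize o 2 = e at *
  generalize o (x + ε) = A at *
  generalize o (x + 4 * ε) = B at *
  generalize o (x + 2) = C at *
  generalize o (x - 2) = D at *
  generalize o (dupl ε x) = F at *
  refine ⟨?_, ?_, ?_⟩
  · intro _; omega
  · intro _ _; omega
  · intro _ _; omega

theorem ord_eight_neg {K : Type*} [Field K] [CharZero K] {o : K → ℤ} (h : OrdFun o) (x m : K)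
    (hm : x - 1 = m ^ 2) (h2 : x - 2 ≠ 0) (h5 : 4 * o (x - 2) = 5 * o 2) : (8 : ℤ) ∣ o 2 := by
  have e1 : (m - 1) * (m + 1) = x - 2 := by linear_combination -hm
  have a1 : m - 1 ≠ 0 := by intro h0; rw [h0, zero_mul] at e1; exact h2 e1.symm
  have a2 : m + 1 ≠ 0 := by intro h0; rw [h0, mul_zero] at e1; exact h2 e1.symm
  rw [← e1, h.mul _ _ a1 a2] at h5
  have t := h.tri (m - 1) 2 (m + 1) a1 two_ne_zero a2 (by ring)
  have := h.two
  omega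

theorem ord_eight_pos {K : Type*} [Field K] [CharZero K] {o : K → ℤ} (h : OrdFun o) (x m b : K)
    (hm : x + 1 = m ^ 2) (hb : x * (x + 4) = b ^ 2) (h0 : x ≠ 0) (h1 : x + 1 ≠ 0)
    (h4 : x + 4 ≠ 0) (h2 : x + 2 ≠ 0) (k0 : o x = o 2) (k1 : o (x + 1) = 0) (k4 : o (x + 4) = o 2)
    (h5 : 4 * o (x + 2) = 5 * o 2) : (8 : ℤ) ∣ o 2 := by
  have hm0 : m ≠ 0 := by rintro rfl; apply h1; rw [hm]; ring
  have hb0 : b ≠ 0 := by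
    rintro rfl
    exact mul_ne_zero h0 h4 (by rw [hb]; ring)
  have om : o m = 0 := by
    rw [hm, pow_two, h.mul _ _ hm0 hm0] at k1; omega
  have ob : o b = o 2 := by
    have := congrArg o hb
    rw [pow_two, h.mul _ _ hb0 hb0, h.mul _ _ h0 h4] at this; omega
  have o2b : o (2 * b) = 2 * o 2 := by rw [h.mul _ _ two_ne_zero hb0]; omega
  have o4m : o (4 * m) = 2 * o 2 := by rw [h.mul _ _ (by norm_num) hm0, h.four]; omega
  have prod : ((x + 2 + 2 * m + b) * (x + 2 + 2 * m - b)) *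
      ((x + 2 - 2 * m + b) * (x + 2 - 2 * m - b)) = -(2 * 2 * (2 * 2) * (x * ((x + 2) * (x + 2)))) := by
    have q1 : (x + 2 + 2 * m + b) * (x + 2 + 2 * m - b) = 4 * (x + 2) * (1 + m) := by
      linear_combination hb - 4 * hm
    have q2 : (x + 2 - 2 * m + b) * (x + 2 - 2 * m - b) = 4 * (x + 2) * (1 - m) := by
      linear_combination hb - 4 * hm
    rw [q1, q2]; linear_combination (16 * (x + 2) ^ 2) * hm
  have hne : ((x + 2 + 2 * m + b) * (x + 2 + 2 * m - b)) *
      ((x + 2 - 2 * m + b) * (x + 2 - 2 * m - b)) ≠ 0 := by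
    rw [prod]; simp [h0, h2]
  have n12 := left_ne_zero_of_mul hne
  have n34 := right_ne_zero_of_mul hne
  have n1 := left_ne_zero_of_mul n12
  have n2 := right_ne_zero_of_mul n12
  have n3 := left_ne_zero_of_mul n34
  have n4 := right_ne_zero_of_mul n34
  have hp := congrArg o prod
  rw [h.neg _ (by simp [h0, h2]), h.mul _ _ n12 n34, h.mul _ _ n1 n2, h.mul _ _ n3 n4,
    h.mul _ _ (by norm_num) (by simp [h0, h2]), h.mul _ _ h0 (by simp [h2]), h.mul _ _ h2 h2,
    h.mul _ _ (by norm_num) (by norm_num), h.mul _ _ two_ne_zero two_ne_zero] at hp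
  have t1 := h.tri _ (2 * b) _ n2 (by simp [hb0]) n1 (by ring)
  have t2 := h.tri _ (2 * b) _ n4 (by simp [hb0]) n3 (by ring)
  have t3 := h.tri _ (4 * m) _ n3 (by simp [hm0]) n1 (by ring)
  have t4 := h.tri _ (4 * m) _ n4 (by simp [hm0]) n2 (by ring)
  rw [o2b] at t1 t2
  rw [o4m] at t3 t4
  have := h.two
  generalize o (x + 2 + 2 * m + b) = A at *
  generalize o (x + 2 + 2 * m - b) = B at *
  generalize o (x + 2 - 2 * m + b) = C at *
  generalize o (x + 2 - 2 * m - b) = D at *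
  have : 8 * A = 15 * o 2 := by omega
  omega

/-- the forward orbit under duplication reaches a root -/
inductive Hits {K : Type*} [Field K] (ε : K) : K → Prop
  | root (x : K) : x = 0 ∨ x + ε = 0 ∨ x + 4 * ε = 0 → Hits ε x
  | step (x : K) : x ≠ 0 → x + ε ≠ 0 → x + 4 * ε ≠ 0 → Hits ε (dupl ε x) → Hits ε x

theorem dupl_sq {K : Type*} [Field K] [CharZero K] {ε x y : K} (he : ε ^ 2 = 1) (hy : y ≠ 0)
    (h : y ^ 2 = x * (x + ε) * (x + 4 * ε)) :
    dupl ε x = ((x ^ 2 - 4) / (2 * y)) ^ 2 ∧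
    dupl ε x + ε = ((x ^ 2 + 2 * ε * x + 4) / (2 * y)) ^ 2 ∧
    dupl ε x + 4 * ε = ((x ^ 2 + 8 * ε * x + 4) / (2 * y)) ^ 2 := by
  have e : dupl ε x = (x ^ 2 - 4) ^ 2 / (4 * y ^ 2) := by rw [dupl, h]
  have h' : y ^ 2 = x ^ 3 + 5 * ε * x ^ 2 + 4 * x := by
    rw [h]; linear_combination 4 * x * he
  refine ⟨?_, ?_, ?_⟩
  · rw [e]; field_simp; ring
  · rw [e, div_add' _ _ _ (by simp [hy]), div_pow, mul_pow]
    norm_num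
    congr 1
    rw [h']; linear_combination (16 * x ^ 2) * he
  · rw [e, div_add' _ _ _ (by simp [hy]), div_pow, mul_pow]
    norm_num
    congr 1
    rw [h']; linear_combination (16 * x ^ 2) * he

theorem hits_of_finite {K : Type*} [Field K] [NumberField K]
    (hn : Module.finrank ℚ K < 8 ∨ Odd (Module.finrank ℚ K)) {ε : K} (he : ε = 1 ∨ ε = -1)
    (hfin : {x : K | ∃ y, y ^ 2 = x * (x + ε) * (x + 4 * ε)}.Finite) (x y : K)
    (h : y ^ 2 = x * (x + ε) * (x + 4 * ε)) : Hits ε x := by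
  by_contra hcon
  have he2 : ε ^ 2 = 1 := by rcases he with rfl | rfl <;> norm_num
  obtain ⟨o, ho, h8⟩ := exists_ordFun K hn
  have nonroot : ∀ x, ¬ Hits ε x → x ≠ 0 ∧ x + ε ≠ 0 ∧ x + 4 * ε ≠ 0 := by
    intro x hx
    refine ⟨fun h => hx (.root x (.inl h)), fun h => hx (.root x (.inr (.inl h))),
      fun h => hx (.root x (.inr (.inr h)))⟩
  let s : ℕ → K := fun n => (dupl ε)^[n] x
  have hs : ∀ n, s (n + 1) = dupl ε (s n) := fun n => Function.iterate_succ_apply' _ _ _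
  have hnh : ∀ n, ¬ Hits ε (s n) := by
    intro n
    induction n with
    | zero => exact hcon
    | succ n ih =>
      obtain ⟨a, b, c⟩ := nonroot _ ih
      intro hh
      rw [hs] at hh
      exact ih (.step _ a b c hh)
  have hon : ∀ n, ∃ y, y ≠ 0 ∧ y ^ 2 = s n * (s n + ε) * (s n + 4 * ε) := by
    intro n
    have aux : ∃ y, y ^ 2 = s n * (s n + ε) * (s n + 4 * ε) := by
      induction n with
      | zero => exact ⟨y, h⟩
      | succ n ih =>
        obtain ⟨y, hy⟩ := ih
        obtain ⟨a, b, c⟩ := nonroot _ (hnh n)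
        have hy0 : y ≠ 0 := by
          rintro rfl
          exact mul_ne_zero (mul_ne_zero a b) c (by rw [← hy]; ring)
        obtain ⟨e1, e2, e3⟩ := dupl_sq he2 hy0 hy
        refine ⟨(s n ^ 2 - 4) / (2 * y) * ((s n ^ 2 + 2 * ε * s n + 4) / (2 * y)) *
          ((s n ^ 2 + 8 * ε * s n + 4) / (2 * y)), ?_⟩
        rw [hs, mul_pow, mul_pow, ← e1, ← e2, ← e3]
    obtain ⟨y, hy⟩ := aux
    obtain ⟨a, b, c⟩ := nonroot _ (hnh n)
    refine ⟨y, ?_, hy⟩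
    rintro rfl
    exact mul_ne_zero (mul_ne_zero a b) c (by rw [← hy]; ring)
  have hrange : (Set.range fun n => o (s n)).Finite := by
    have : (Set.range s).Finite := hfin.subset (by
      rintro _ ⟨n, rfl⟩
      obtain ⟨y, _, hy⟩ := hon n
      exact ⟨y, hy⟩)
    have := this.image o
    rwa [← Set.range_comp] at this
  obtain ⟨N, hN⟩ : ∃ N, ∀ n, o (s N) ≤ o (s n) := by
    obtain ⟨_, ⟨N, rfl⟩, h2⟩ := hrange.exists_minimal (Set.range_nonempty _)
    refine ⟨N, fun n => ?_⟩
    by_contra hlt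
    push Not at hlt
    have := h2 ⟨n, rfl⟩ hlt.le
    simp only at this
    omega
  have hd : ∀ n, _ := fun n => ord_dupl ho ε (s n) he2 (nonroot _ (hnh n)).1 (nonroot _ (hnh n)).2.1
    (nonroot _ (hnh n)).2.2 (by rw [← hs]; exact (nonroot _ (hnh (n + 1))).1)
  simp only [← hs] at hd
  have hge : ∀ n, 0 ≤ o (s n) := by
    intro n
    have h1 := hN n
    have h2 := (hd N).1
    have h3 := hN (N + 1)
    omega
  have heq : ∀ n, o (s n) = o 2 := by
    intro n
    by_contra hne
    have h1 := (hd n).2.1 (hge n) hne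
    have h2 := hge (n + 1)
    omega
  obtain ⟨k1, k2, k3, k4⟩ := (hd 1).2.2 (heq 1) (heq 2)
  obtain ⟨y, hy0, hy⟩ := hon 0
  obtain ⟨e1, e2, e3⟩ := dupl_sq he2 hy0 hy
  rw [← hs] at e1 e2 e3
  obtain ⟨a, b, c⟩ := nonroot _ (hnh 1)
  have a2 : s 2 ≠ 0 := (nonroot _ (hnh 2)).1
  rw [hs] at a2
  have hpm : s 1 ^ 2 - 4 ≠ 0 := by
    intro h0; apply a2; rw [dupl, h0]; simp
  have hp2 : s 1 + 2 ≠ 0 := by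
    intro h0; apply hpm; linear_combination (s 1 - 2) * h0
  have hm2 : s 1 - 2 ≠ 0 := by
    intro h0; apply hpm; linear_combination (s 1 + 2) * h0
  simp only [zero_add] at e1 e2 e3
  rcases he with rfl | rfl
  · rw [mul_one] at c k2 e3
    refine h8 (ord_eight_pos ho (s 1) _ ((s 0 ^ 2 - 4) / (2 * y) *
      ((s 0 ^ 2 + 8 * 1 * s 0 + 4) / (2 * y))) e2 ?_ a b c hp2 (heq 1) k1 k2 k4)
    rw [mul_pow, ← e3, ← e1]
  · exact h8 (ord_eight_neg ho (s 1) _ (by rw [← e2]; ring) hm2 k3)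

theorem quad_finite {K : Type*} [Field K] (b c : K) : {X : K | X ^ 2 + b * X + c = 0}.Finite := by
  by_cases h : ∃ X0 : K, X0 ^ 2 + b * X0 + c = 0
  · obtain ⟨X0, h0⟩ := h
    refine (Set.toFinite {X0, -b - X0}).subset ?_
    intro X hX
    have hX' : X ^ 2 + b * X + c = 0 := hX
    have : (X - X0) * (X - (-b - X0)) = 0 := by linear_combination hX' - h0
    rcases mul_eq_zero.mp this with h | h
    · left; exact sub_eq_zero.mp h
    · right; exact sub_eq_zero.mp h
  · convert Set.finite_empty
    ext X
    simp only [Set.mem_ofPred_eq, Set.mem_empty_iff_false, iff_false]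
    exact fun hX => h ⟨X, hX⟩

theorem finite_isog {K : Type*} [Field K] [CharZero K] {ε : K} (he : ε ^ 2 = 1)
    (hf : {p : K × K | p.2 ^ 2 = p.1 ^ 3 - ε * p.1 ^ 2 + p.1}.Finite) :
    {x : K | ∃ y, y ^ 2 = x * (x + ε) * (x + 4 * ε)}.Finite := by
  have hT := hf.image Prod.fst
  have hU := hT.biUnion (t := fun t : K => {X : K | X ^ 2 + (4 * ε - 4 * t) * X + (-4 * t * ε) = 0})
    (fun t _ => quad_finite _ _)
  refine (hU.union (Set.finite_singleton (-ε))).subset ?_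
  rintro X ⟨Y, hY⟩
  by_cases hX : X + ε = 0
  · right; exact eq_neg_of_add_eq_zero_left hX
  left
  have := isog he hX hY
  simp only [Set.mem_iUnion, Set.mem_image]
  refine ⟨_, ⟨(_, _), this, rfl⟩, ?_⟩
  simp only [Set.mem_ofPred_eq]
  field_simp
  linear_combination (-3) * (X + ε) * he

theorem hits_pos {K : Type*} [Field K] [NumberField K]
    (hn : Module.finrank ℚ K < 8 ∨ Odd (Module.finrank ℚ K))
    (hf : {p : K × K | p.2 ^ 2 = p.1 ^ 3 - p.1 ^ 2 + p.1}.Finite) (x y : K)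
    (h : y ^ 2 = x * (x + 1) * (x + 4)) : Hits 1 x := by
  refine hits_of_finite hn (Or.inl rfl) (finite_isog (by norm_num) ?_) x y (by rw [h]; ring)
  simpa using hf

theorem hits_neg {K : Type*} [Field K] [NumberField K]
    (hn : Module.finrank ℚ K < 8 ∨ Odd (Module.finrank ℚ K))
    (hf : {p : K × K | p.2 ^ 2 = p.1 ^ 3 + p.1 ^ 2 + p.1}.Finite) (x y : K)
    (h : y ^ 2 = x * (x - 1) * (x - 4)) : Hits (-1) x := by
  refine hits_of_finite hn (Or.inr rfl) (finite_isog (by norm_num) ?_) x y (by rw [h]; ring)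
  simpa using hf

open IntermediateField in
theorem adj_form {F K : Type*} [Field F] [Field K] [Algebra F K] [Algebra.IsAlgebraic F K]
    (w : K) (c : F) (hw : w ^ 2 = algebraMap F K c) (x : K) (hx : x ∈ F⟮w⟯) :
    ∃ a b : F, x = algebraMap F K a + algebraMap F K b * w := by
  have h1 : x ∈ (F⟮w⟯).toSubalgebra := hx
  rw [IntermediateField.adjoin_simple_toSubalgebra_of_isAlgebraic
    (Algebra.IsAlgebraic.isAlgebraic w)] at h1
  clear hx
  induction h1 using Algebra.adjoin_induction with
  | mem x hx =>
    obtain rfl : x = w := by simpa using hx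
    exact ⟨0, 1, by simp⟩
  | algebraMap r => exact ⟨r, 0, by simp⟩
  | add x y _ _ hx hy =>
    obtain ⟨a, b, rfl⟩ := hx
    obtain ⟨a', b', rfl⟩ := hy
    exact ⟨a + a', b + b', by simp only [map_add]; ring⟩
  | mul x y _ _ hx hy =>
    obtain ⟨a, b, rfl⟩ := hx
    obtain ⟨a', b', rfl⟩ := hy
    refine ⟨a * a' + b * b' * c, a * b' + a' * b, ?_⟩
    simp only [map_add, map_mul]
    linear_combination (algebraMap F K b * algebraMap F K b') * hw

open IntermediateField in
theorem adj_deg {F K : Type*} [Field F] [Field K] [Algebra F K] [Algebra.IsAlgebraic F K]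
    (w : K) (c : F) (hw : w ^ 2 = algebraMap F K c) (hn : ∀ a : F, algebraMap F K a ≠ w) :
    Module.finrank F F⟮w⟯ = 2 := by
  have hi : IsIntegral F w := (Algebra.IsAlgebraic.isAlgebraic w).isIntegral
  rw [IntermediateField.adjoin.finrank hi]
  apply le_antisymm
  · have hm : (Polynomial.X ^ 2 - Polynomial.C c).Monic := Polynomial.monic_X_pow_sub_C c two_ne_zero
    have := minpoly.min F w hm (by simp [hw])
    have := Polynomial.natDegree_le_natDegree this
    rwa [Polynomial.natDegree_X_pow_sub_C] at this
  · rw [minpoly.two_le_natDegree_iff hi]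
    rintro ⟨a, ha⟩
    exact hn a ha

open IntermediateField in
theorem span_four {K : Type*} [Field K] [NumberField K]
    (hn : Module.finrank ℚ K < 8 ∨ Odd (Module.finrank ℚ K)) (r w : K) (d a b : ℚ)
    (hr : r ^ 2 = d) (hr' : ∀ q : ℚ, (q : K) ≠ r) (hw : w ^ 2 = a + b * r)
    (hw' : ∀ p q : ℚ, (p : K) + q * r ≠ w) (x : K) :
    ∃ p q p' q' : ℚ, x = p + q * r + (p' + q' * r) * w := by
  have d1 : Module.finrank ℚ ℚ⟮r⟯ = 2 := adj_deg r d (by simpa using hr) (by simpa using hr')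
  let r' : ℚ⟮r⟯ := ⟨r, mem_adjoin_simple_self ℚ r⟩
  have hw2 : w ^ 2 = algebraMap ℚ⟮r⟯ K (a + b * r') := by
    rw [hw]; simp [r']
  have form1 : ∀ y : ℚ⟮r⟯, ∃ p q : ℚ, algebraMap ℚ⟮r⟯ K y = p + q * r := by
    intro y
    obtain ⟨p, q, h⟩ := adj_form r d (by simpa using hr) (y : K) y.2
    exact ⟨p, q, by simpa using h⟩
  have d2 : Module.finrank ℚ⟮r⟯ (ℚ⟮r⟯⟮w⟯) = 2 := by
    apply adj_deg w _ hw2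
    intro y hy
    obtain ⟨p, q, h⟩ := form1 y
    exact hw' p q (by rw [← h, hy])
  have e1 := Module.finrank_mul_finrank ℚ ℚ⟮r⟯ K
  have e2 := Module.finrank_mul_finrank ℚ⟮r⟯ (ℚ⟮r⟯⟮w⟯) K
  rw [d1] at e1
  rw [d2] at e2
  have hpos : 0 < Module.finrank (ℚ⟮r⟯⟮w⟯) K := Module.finrank_pos
  have h1 : Module.finrank (ℚ⟮r⟯⟮w⟯) K = 1 := by
    rcases hn with h | h
    · omega
    · rw [Nat.odd_iff] at h; omega
  rw [IntermediateField.finrank_eq_one_iff_eq_top] at h1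
  have hx : x ∈ ℚ⟮r⟯⟮w⟯ := by rw [h1]; trivial
  obtain ⟨y, z, h⟩ := adj_form w _ hw2 x hx
  obtain ⟨p, q, hy⟩ := form1 y
  obtain ⟨p', q', hz⟩ := form1 z
  exact ⟨p, q, p', q', by rw [h, hy, hz]⟩

/-- a non-square integer stays a non-square in the rationals -/
theorem nsq (n : ℤ) (hn : ¬ IsSquare n) {x y : ℚ} (h : x ^ 2 = n * y ^ 2) : x = 0 ∧ y = 0 := by
  have hy : y = 0 := by
    by_contra hy
    apply hn
    rw [← Rat.isSquare_intCast_iff]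
    exact ⟨x / y, by field_simp; linarith⟩
  refine ⟨?_, hy⟩
  rw [hy] at h
  simpa using h

theorem nsq' (n : ℤ) (hn : ¬ IsSquare n) (x : ℚ) : x ^ 2 ≠ n := by
  intro h
  have := nsq n hn (x := x) (y := 1) (by simpa using h)
  exact one_ne_zero this.2

section
variable {K : Type*} [Field K] [CharZero K]

theorem indep_two {n : ℤ} (hn : ¬ IsSquare n) {s : K} (hs : s ^ 2 = n) {a b : ℚ}
    (h : (a : K) + b * s = 0) : a = 0 ∧ b = 0 := by
  apply nsq n hn
  have : (a : K) ^ 2 = n * b ^ 2 := by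
    rw [← hs]; linear_combination (a - b * s) * h
  exact_mod_cast this

theorem nsq_of_lt (k : ℤ) {n : ℤ} (hk : 0 ≤ k) (h1 : k * k < n) (h2 : n < (k + 1) * (k + 1)) :
    ¬ IsSquare n := by
  rintro ⟨x, rfl⟩
  rcases le_total 0 x with hx | hx
  · have : k < x := by nlinarith
    nlinarith
  · have : k < -x := by nlinarith
    nlinarith

theorem nsq2 : ¬ IsSquare (2 : ℤ) := nsq_of_lt 1 (by norm_num) (by norm_num) (by norm_num)
theorem nsq3 : ¬ IsSquare (3 : ℤ) := nsq_of_lt 1 (by norm_num) (by norm_num) (by norm_num)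

theorem indep_sj {s j : K} (hs : s ^ 2 = 2) (hj : j ^ 2 = -1) {a b c d : ℚ}
    (h : (a : K) + b * s + c * j + d * (s * j) = 0) : a = 0 ∧ b = 0 ∧ c = 0 ∧ d = 0 := by
  have h1 : ((a ^ 2 + 2 * b ^ 2 + c ^ 2 + 2 * d ^ 2 : ℚ) : K) + ((2 * (a * b + c * d) : ℚ) : K) * s
      = 0 := by
    push_cast
    linear_combination (a + b * s - (c + d * s) * j) * h + (c + d * s) ^ 2 * hj - (b ^ 2 + d ^ 2) * hs
  have h2 := (indep_two nsq2 (by simpa using hs) h1).1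
  have := sq_nonneg a; have := sq_nonneg b; have := sq_nonneg c; have := sq_nonneg d
  refine ⟨?_, ?_, ?_, ?_⟩ <;> refine pow_eq_zero_iff two_ne_zero |>.mp ?_ <;> linarith

theorem indep_rw {r w : K} (hr : r ^ 2 = 3) (hw : w ^ 2 = 2 * r) {a b c d : ℚ}
    (h : (a : K) + b * r + (c + d * r) * w = 0) : a = 0 ∧ b = 0 ∧ c = 0 ∧ d = 0 := by
  have h1 : ((a ^ 2 + 3 * b ^ 2 - 12 * (c * d) : ℚ) : K)
      + ((2 * (a * b) - 2 * (c ^ 2 + 3 * d ^ 2) : ℚ) : K) * r = 0 := by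
    push_cast
    linear_combination (a + b * r - (c + d * r) * w) * h + (c + d * r) ^ 2 * hw
      + (4 * c * d + 2 * d ^ 2 * r - b ^ 2) * hr
  obtain ⟨h2, h3⟩ := indep_two nsq3 (by simpa using hr) h1
  have h4 : (a ^ 2 - 3 * b ^ 2) ^ 2 + 12 * (c ^ 2 - 3 * d ^ 2) ^ 2 = 0 := by
    linear_combination (a ^ 2 + 3 * b ^ 2 + 12 * c * d) * h2
      - 6 * (a * b + (c ^ 2 + 3 * d ^ 2)) * h3
  have h5 : a ^ 2 - 3 * b ^ 2 = 0 := by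
    refine pow_eq_zero_iff two_ne_zero |>.mp ?_
    nlinarith [sq_nonneg (a ^ 2 - 3 * b ^ 2), sq_nonneg (c ^ 2 - 3 * d ^ 2)]
  have h6 : c ^ 2 - 3 * d ^ 2 = 0 := by
    refine pow_eq_zero_iff two_ne_zero |>.mp ?_
    nlinarith [sq_nonneg (a ^ 2 - 3 * b ^ 2), sq_nonneg (c ^ 2 - 3 * d ^ 2)]
  obtain ⟨a0, b0⟩ := nsq 3 nsq3 (x := a) (y := b) (by push_cast; linarith)
  obtain ⟨c0, d0⟩ := nsq 3 nsq3 (x := c) (y := d) (by push_cast; linarith)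
  exact ⟨a0, b0, c0, d0⟩

/-- every element is a rational combination of `1, s, j, s j` -/
def SpanSJ (K : Type*) [Field K] [CharZero K] : Prop :=
  ∀ j s : K, j ^ 2 = -1 → s ^ 2 = 2 → ∀ m : K, ∃ a b c d : ℚ, m = a + b * s + c * j + d * (s * j)

theorem norm_one (hK : SpanSJ K) {s j m : K} (hs : s ^ 2 = 2) (hj : j ^ 2 = -1) {u v : ℚ}
    (h : m ^ 2 = u + v * s) : ∃ t : ℚ, t ^ 2 = u ^ 2 - 2 * v ^ 2 := by
  obtain ⟨a, b, c, d, rfl⟩ := hK j s hj hs m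
  have h1 : ((a ^ 2 + 2 * b ^ 2 - c ^ 2 - 2 * d ^ 2 - u : ℚ) : K) +
      ((2 * a * b - 2 * c * d - v : ℚ) : K) * s + ((2 * (a * c + 2 * b * d) : ℚ) : K) * j +
      ((2 * (a * d + b * c) : ℚ) : K) * (s * j) = 0 := by
    push_cast
    linear_combination h - (c + d * s) ^ 2 * hj + (d ^ 2 - b ^ 2 - 2 * b * d * j) * hs
  obtain ⟨e1, e2, e3, e4⟩ := indep_sj hs hj h1
  have hp : (a ^ 2 - 2 * b ^ 2) * (c ^ 2 - 2 * d ^ 2) = 0 := by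
    linear_combination (a * c + 2 * b * d) / 2 * e3 - (a * d + b * c) * e4
  have hu : u = a ^ 2 + 2 * b ^ 2 - c ^ 2 - 2 * d ^ 2 := by linarith
  have hv : v = 2 * a * b - 2 * c * d := by linarith
  rcases mul_eq_zero.mp hp with h | h
  · obtain ⟨rfl, rfl⟩ := nsq 2 nsq2 (x := a) (y := b) (by push_cast; linarith)
    exact ⟨c ^ 2 - 2 * d ^ 2, by rw [hu, hv]; ring⟩
  · obtain ⟨rfl, rfl⟩ := nsq 2 nsq2 (x := c) (y := d) (by push_cast; linarith)
    exact ⟨a ^ 2 - 2 * b ^ 2, by rw [hu, hv]; ring⟩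

theorem norm_two (hK : SpanSJ K) {s j m : K} (hs : s ^ 2 = 2) (hj : j ^ 2 = -1) {u v u' v' : ℚ}
    (h : m ^ 2 = u + v * s + u' * j + v' * (s * j)) :
    ∃ t : ℚ, t ^ 2 = (u ^ 2 + 2 * v ^ 2 + u' ^ 2 + 2 * v' ^ 2) ^ 2
      - 2 * (2 * (u * v + u' * v')) ^ 2 := by
  obtain ⟨a, b, c, d, rfl⟩ := hK j s hj hs m
  have h1 : ((a ^ 2 + 2 * b ^ 2 - c ^ 2 - 2 * d ^ 2 - u : ℚ) : K) +
      ((2 * a * b - 2 * c * d - v : ℚ) : K) * s + ((2 * (a * c + 2 * b * d) - u' : ℚ) : K) * j +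
      ((2 * (a * d + b * c) - v' : ℚ) : K) * (s * j) = 0 := by
    push_cast
    linear_combination h - (c + d * s) ^ 2 * hj + (d ^ 2 - b ^ 2 - 2 * b * d * j) * hs
  obtain ⟨e1, e2, e3, e4⟩ := indep_sj hs hj h1
  obtain rfl : u = a ^ 2 + 2 * b ^ 2 - c ^ 2 - 2 * d ^ 2 := by linarith
  obtain rfl : v = 2 * a * b - 2 * c * d := by linarith
  obtain rfl : u' = 2 * (a * c + 2 * b * d) := by linarith
  obtain rfl : v' = 2 * (a * d + b * c) := by linarith
  exact ⟨(a ^ 2 + 2 * b ^ 2 + c ^ 2 + 2 * d ^ 2) ^ 2 - 2 * (2 * a * b + 2 * c * d) ^ 2, by ring⟩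

theorem norm_sixteen (hK : SpanSJ K) {s j m : K} (hs : s ^ 2 = 2) (hj : j ^ 2 = -1)
    (h : m ^ 2 = (j - 1) * (2 + s)) : False := by
  obtain ⟨a, b, c, d, rfl⟩ := hK j s hj hs m
  have h1 : ((a ^ 2 + 2 * b ^ 2 - c ^ 2 - 2 * d ^ 2 + 2 : ℚ) : K) +
      ((2 * a * b - 2 * c * d + 1 : ℚ) : K) * s + ((2 * (a * c + 2 * b * d) - 2 : ℚ) : K) * j +
      ((2 * (a * d + b * c) - 1 : ℚ) : K) * (s * j) = 0 := by
    push_cast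
    linear_combination h - (c + d * s) ^ 2 * hj + (d ^ 2 - b ^ 2 - 2 * b * d * j) * hs
  obtain ⟨e1, e2, e3, e4⟩ := indep_sj hs hj h1
  -- norm to the field generated by `j`: `(x + y j) ^ 2 = -4 j`
  obtain ⟨x, hx⟩ : ∃ x, x = a ^ 2 - c ^ 2 - 2 * (b ^ 2 - d ^ 2) := ⟨_, rfl⟩
  obtain ⟨y, hy⟩ : ∃ y, y = 2 * a * c - 4 * b * d := ⟨_, rfl⟩
  have f1 : x ^ 2 - y ^ 2 = 0 := by
    rw [hx, hy]
    have g1 : a ^ 2 + 2 * b ^ 2 - c ^ 2 - 2 * d ^ 2 = -2 := by linarith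
    have g2 : 2 * a * b - 2 * c * d = -1 := by linarith
    have g3 : 2 * (a * c + 2 * b * d) = 2 := by linarith
    have g4 : 2 * (a * d + b * c) = 1 := by linarith
    calc _ = (a ^ 2 + 2 * b ^ 2 - c ^ 2 - 2 * d ^ 2) ^ 2 - (2 * (a * c + 2 * b * d)) ^ 2
        - 2 * (2 * a * b - 2 * c * d) ^ 2 + 2 * (2 * (a * d + b * c)) ^ 2 := by ring
      _ = 0 := by rw [g1, g2, g3, g4]; norm_num
  have f2 : x * y = -2 := by
    rw [hx, hy]
    have g1 : a ^ 2 + 2 * b ^ 2 - c ^ 2 - 2 * d ^ 2 = -2 := by linarith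
    have g2 : 2 * a * b - 2 * c * d = -1 := by linarith
    have g3 : 2 * (a * c + 2 * b * d) = 2 := by linarith
    have g4 : 2 * (a * d + b * c) = 1 := by linarith
    calc _ = (a ^ 2 + 2 * b ^ 2 - c ^ 2 - 2 * d ^ 2) * (2 * (a * c + 2 * b * d))
        - 2 * (2 * a * b - 2 * c * d) * (2 * (a * d + b * c)) := by ring
      _ = -2 := by rw [g1, g2, g3, g4]; norm_num
  have f3 : (x - y) * (x + y) = 0 := by linarith
  rcases mul_eq_zero.mp f3 with h | h
  · obtain rfl : x = y := by linarith
    nlinarith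
  · obtain rfl : y = -x := by linarith
    exact nsq' 2 nsq2 x (by push_cast; linarith)

/-- every element is a rational combination of `1, r, w, r w` -/
def SpanRW (K : Type*) [Field K] [CharZero K] : Prop :=
  ∀ r w : K, r ^ 2 = 3 → w ^ 2 = 2 * r → ∀ m : K, ∃ a b c d : ℚ, m = a + b * r + (c + d * r) * w

theorem norm_rw_one (hK : SpanRW K) {r w m : K} (hr : r ^ 2 = 3) (hw : w ^ 2 = 2 * r) {u v : ℚ}
    (h : m ^ 2 = u + v * r) :
    ∃ t : ℚ, t ^ 2 = u ^ 2 - 3 * v ^ 2 ∨ t ^ 2 = -12 * (u ^ 2 - 3 * v ^ 2) := by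
  obtain ⟨a, b, c, d, rfl⟩ := hK r w hr hw m
  have h1 : ((a ^ 2 + 3 * b ^ 2 + 12 * c * d - u : ℚ) : K) +
      ((2 * a * b + 2 * (c ^ 2 + 3 * d ^ 2) - v : ℚ) : K) * r + (((2 * (a * c + 3 * b * d) : ℚ) : K)
      + ((2 * (a * d + b * c) : ℚ) : K) * r) * w = 0 := by
    push_cast
    linear_combination h - (c + d * r) ^ 2 * hw - (b ^ 2 + 4 * c * d + 2 * d ^ 2 * r + 2 * b * d * w) * hr
  obtain ⟨e1, e2, e3, e4⟩ := indep_rw hr hw h1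
  have hp : (a ^ 2 - 3 * b ^ 2) * (c ^ 2 - 3 * d ^ 2) = 0 := by
    linear_combination (a * c + 3 * b * d) / 2 * e3 - 3 / 2 * (a * d + b * c) * e4
  obtain rfl : u = a ^ 2 + 3 * b ^ 2 + 12 * c * d := by linarith
  obtain rfl : v = 2 * a * b + 2 * (c ^ 2 + 3 * d ^ 2) := by linarith
  rcases mul_eq_zero.mp hp with h | h
  · obtain ⟨rfl, rfl⟩ := nsq 3 nsq3 (x := a) (y := b) (by push_cast; linarith)
    exact ⟨12 * (c ^ 2 - 3 * d ^ 2), Or.inr (by ring)⟩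
  · obtain ⟨rfl, rfl⟩ := nsq 3 nsq3 (x := c) (y := d) (by push_cast; linarith)
    exact ⟨a ^ 2 - 3 * b ^ 2, Or.inl (by ring)⟩

/-- `b ^ 2 = U + V w` forces the norm of `U ^ 2 - 2 r V ^ 2 = x + y r` to be a square -/
theorem norm_rw_two (hK : SpanRW K) {r w m : K} (hr : r ^ 2 = 3) (hw : w ^ 2 = 2 * r)
    {u v u' v' x y : ℚ} (h : m ^ 2 = u + v * r + (u' + v' * r) * w)
    (hx : x = u ^ 2 + 3 * v ^ 2 - 12 * u' * v') (hy : y = 2 * u * v - 2 * (u' ^ 2 + 3 * v' ^ 2)) :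
    ∃ t : ℚ, t ^ 2 = x ^ 2 - 3 * y ^ 2 := by
  obtain ⟨a, b, c, d, rfl⟩ := hK r w hr hw m
  have h1 : ((a ^ 2 + 3 * b ^ 2 + 12 * c * d - u : ℚ) : K) +
      ((2 * a * b + 2 * (c ^ 2 + 3 * d ^ 2) - v : ℚ) : K) * r +
      (((2 * (a * c + 3 * b * d) - u' : ℚ) : K)
      + ((2 * (a * d + b * c) - v' : ℚ) : K) * r) * w = 0 := by
    push_cast
    linear_combination h - (c + d * r) ^ 2 * hw - (b ^ 2 + 4 * c * d + 2 * d ^ 2 * r + 2 * b * d * w) * hr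
  obtain ⟨e1, e2, e3, e4⟩ := indep_rw hr hw h1
  obtain rfl : u = a ^ 2 + 3 * b ^ 2 + 12 * c * d := by linarith
  obtain rfl : v = 2 * a * b + 2 * (c ^ 2 + 3 * d ^ 2) := by linarith
  obtain rfl : u' = 2 * (a * c + 3 * b * d) := by linarith
  obtain rfl : v' = 2 * (a * d + b * c) := by linarith
  refine ⟨(a ^ 2 + 3 * b ^ 2 - 12 * c * d) ^ 2 - 3 * (2 * a * b - 2 * (c ^ 2 + 3 * d ^ 2)) ^ 2, ?_⟩
  rw [hx, hy]; ring

end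

section
variable {K : Type*} [Field K] [NumberField K]

theorem spanSJ_of_deg (hn : Module.finrank ℚ K < 8 ∨ Odd (Module.finrank ℚ K)) : SpanSJ K := by
  intro j s hj hs m
  suffices H : ∃ p q p' q' : ℚ, m = p + q * s + (p' + q' * s) * j by
    obtain ⟨p, q, p', q', h⟩ := H
    exact ⟨p, q, p', q', by rw [h]; ring⟩
  refine span_four hn s j 2 (-1) 0 (by simpa using hs) ?_ (by simpa using hj) ?_ m
  · intro q hq
    have := indep_two nsq2 (s := s) (by simpa using hs) (a := q) (b := -1) (by push_cast; rw [hq]; ring)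
    norm_num at this
  · intro p q hpq
    have := indep_sj hs hj (a := p) (b := q) (c := -1) (d := 0) (by push_cast; rw [hpq]; ring)
    norm_num at this

theorem spanRW_of_deg (hn : Module.finrank ℚ K < 8 ∨ Odd (Module.finrank ℚ K)) : SpanRW K := by
  intro r w hr hw m
  refine span_four hn r w 3 0 2 (by simpa using hr) ?_ (by simpa using hw) ?_ m
  · intro q hq
    have := indep_two nsq3 (s := r) (by simpa using hr) (a := q) (b := -1) (by push_cast; rw [hq]; ring)
    norm_num at this
  · intro p q hpq
    have := indep_rw hr hw (a := p) (b := q) (c := -1) (d := 0) (by push_cast; rw [hpq]; ring)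
    norm_num at this

theorem cyclo_of_deg (hn : Module.finrank ℚ K < 8 ∨ Odd (Module.finrank ℚ K))
    {j r : K} (hj : j ^ 2 = -1) (hr : r ^ 2 = 3) : IsCyclotomicExtension {12} ℚ K := by
  have hspan := span_four hn r j 3 (-1) 0 (by simpa using hr) (by
    intro q hq
    have := indep_two nsq3 (s := r) (by simpa using hr) (a := q) (b := -1) (by push_cast; rw [hq]; ring)
    norm_num at this) (by simpa using hj) (by
    intro p q hpq
    have h1 : ((p ^ 2 + 3 * q ^ 2 + 1 : ℚ) : K) + ((2 * p * q : ℚ) : K) * r = 0 := by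
      push_cast; rw [← hpq] at hj; linear_combination hj - q ^ 2 * hr
    have := (indep_two nsq3 (by simpa using hr) h1).1
    nlinarith [sq_nonneg p, sq_nonneg q])
  obtain ⟨z, hz⟩ : ∃ z, z = (r + j) / 2 := ⟨_, rfl⟩
  have hz2 : 2 * z = r + j := by rw [hz]; ring
  have hz3 : z ^ 3 = j := by
    have : 8 * z ^ 3 = 8 * j := by
      linear_combination (4 * z ^ 2 + 2 * z * (r + j) + (r + j) ^ 2) * hz2 + (r + 3 * j) * hr
        + (3 * r + j) * hj
    exact mul_left_cancel₀ (by norm_num) this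
  have hz6 : z ^ 6 = -1 := by linear_combination (z ^ 3 + j) * hz3 + hj
  have hz12 : z ^ 12 = 1 := by linear_combination (z ^ 6 - 1) * hz6
  have hprim : IsPrimitiveRoot z 12 := by
    have hord : orderOf z = 12 := by
      apply orderOf_eq_of_pow_and_pow_div_prime (by norm_num) hz12
      intro p hp hd
      have : p = 2 ∨ p = 3 := by
        have hle : p ≤ 12 := Nat.le_of_dvd (by norm_num) hd
        interval_cases p <;> revert hp hd <;> decide
      rcases this with rfl | rfl
      · norm_num; rw [hz6]; norm_num
      · norm_num
        intro h4
        have h5 : z * j = 1 := by rw [← h4, ← hz3]; ring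
        have h6 : r = -3 * j := by linear_combination (-2 * j) * h5 - hz2 + 2 * z * hj
        rw [h6] at hr
        have : (12 : K) = 0 := by linear_combination 9 * hj - hr
        norm_num at this
    rw [← hord]
    exact IsPrimitiveRoot.orderOf z
  refine ⟨fun {n} hnS hn0 => ?_, fun x => ?_⟩
  · obtain rfl : n = 12 := by simpa using hnS
    exact ⟨z, hprim⟩
  · have mj : j ∈ Algebra.adjoin ℚ {b : K | ∃ n ∈ ({12} : Set ℕ), n ≠ 0 ∧ b ^ n = 1} := by
      apply Algebra.subset_adjoin
      exact ⟨12, rfl, by norm_num, by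
        linear_combination (j ^ 10 - j ^ 8 + j ^ 6 - j ^ 4 + j ^ 2 - 1) * hj⟩
    have mz : z ∈ Algebra.adjoin ℚ {b : K | ∃ n ∈ ({12} : Set ℕ), n ≠ 0 ∧ b ^ n = 1} := by
      apply Algebra.subset_adjoin
      exact ⟨12, rfl, by norm_num, hz12⟩
    have mr : r ∈ Algebra.adjoin ℚ {b : K | ∃ n ∈ ({12} : Set ℕ), n ≠ 0 ∧ b ^ n = 1} := by
      have : r = z + z - j := by linear_combination -hz2
      rw [this]
      exact sub_mem (add_mem mz mz) mj
    have mq : ∀ q : ℚ, (q : K) ∈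
        Algebra.adjoin ℚ {b : K | ∃ n ∈ ({12} : Set ℕ), n ≠ 0 ∧ b ^ n = 1} := by
      intro q
      have := Subalgebra.algebraMap_mem
        (Algebra.adjoin ℚ {b : K | ∃ n ∈ ({12} : Set ℕ), n ≠ 0 ∧ b ^ n = 1}) q
      simpa using this
    obtain ⟨p, q, p', q', h⟩ := hspan x
    rw [h]
    exact add_mem (add_mem (mq _) (mul_mem (mq _) mr))
      (mul_mem (add_mem (mq _) (mul_mem (mq _) mr)) mj)

end

theorem dupl_rel {K : Type*} [Field K] [CharZero K] {ε x : K} (he : ε ^ 2 = 1)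
    (h1 : x ≠ 0) (h2 : x + ε ≠ 0) (h3 : x + 4 * ε ≠ 0) :
    dupl ε x * (4 * (x * (x + ε) * (x + 4 * ε))) = (x ^ 2 - 4) ^ 2 ∧
    (dupl ε x + ε) * (4 * (x * (x + ε) * (x + 4 * ε))) = (x ^ 2 + 2 * ε * x + 4) ^ 2 ∧
    (dupl ε x + 4 * ε) * (4 * (x * (x + ε) * (x + 4 * ε))) = (x ^ 2 + 8 * ε * x + 4) ^ 2 := by
  have h : dupl ε x * (4 * (x * (x + ε) * (x + 4 * ε))) = (x ^ 2 - 4) ^ 2 := by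
    unfold dupl; field_simp
  refine ⟨h, ?_, ?_⟩
  · linear_combination h + (16 * x ^ 2 + 16 * x * ε) * he
  · linear_combination h + (16 * x ^ 2 + 64 * x * ε) * he

theorem hits_rat {K : Type*} [Field K] [CharZero K] {e : ℚ} (he : e ^ 2 = 1) {x : K}
    (h : Hits (e : K) x) : ∀ q : ℚ, x = q → q = 0 ∨ q = -e ∨ q = -4 * e ∨ q = 2 ∨ q = -2 := by
  induction h with
  | root x hx =>
    rintro q rfl
    rcases hx with h | h | h
    · left; exact_mod_cast h
    · right; left
      have : q + e = 0 := by exact_mod_cast h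
      linarith
    · right; right; left
      have : q + 4 * e = 0 := by exact_mod_cast h
      linarith
  | step x h1 h2 h3 _ ih =>
    rintro q rfl
    have g1 : q ≠ 0 := by exact_mod_cast h1
    have g2 : q + e ≠ 0 := by exact_mod_cast h2
    have g3 : q + 4 * e ≠ 0 := by exact_mod_cast h3
    obtain ⟨r1, r2, r3⟩ := dupl_rel he g1 g2 g3
    have hc := ih (dupl e q) (by unfold dupl; push_cast; rfl)
    generalize dupl e q = f at *
    rcases hc with rfl | rfl | rfl | rfl | rfl
    · have : q ^ 2 - 4 = 0 := by
        refine pow_eq_zero_iff two_ne_zero |>.mp ?_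
        linarith
      have : (q - 2) * (q + 2) = 0 := by linarith
      rcases mul_eq_zero.mp this with h | h
      · right; right; right; left; linarith
      · right; right; right; right; linarith
    · exfalso
      have : q ^ 2 + 2 * e * q + 4 = 0 := by
        refine pow_eq_zero_iff two_ne_zero |>.mp ?_
        linarith
      nlinarith [sq_nonneg (q + e)]
    · exfalso
      have : q ^ 2 + 8 * e * q + 4 = 0 := by
        refine pow_eq_zero_iff two_ne_zero |>.mp ?_
        linarith
      refine nsq' 12 (nsq_of_lt 3 (by norm_num) (by norm_num) (by norm_num)) (q + 4 * e) ?_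
      push_cast
      linear_combination this + 16 * he
    all_goals
      exfalso
      have he' : e = 1 ∨ e = -1 := mul_self_eq_one_iff.mp (by rw [← he]; ring)
      clear ih
    · rcases he' with rfl | rfl
      · refine g1 (nsq 72 (nsq_of_lt 8 (by norm_num) (by norm_num) (by norm_num))
          (x := q ^ 2 - 4 * q + 4) (y := q) ?_).2
        push_cast
        linear_combination -r1
      · apply g2
        refine pow_eq_zero_iff two_ne_zero |>.mp ?_
        have : (q ^ 2 - 4 * q) ^ 2 + 16 * (q - 1) ^ 2 = 0 := by
          linear_combination -r1
        nlinarith [sq_nonneg (q ^ 2 - 4 * q), sq_nonneg (q - 1)]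
    · rcases he' with rfl | rfl
      · apply g2
        refine pow_eq_zero_iff two_ne_zero |>.mp ?_
        have : (q ^ 2 + 4 * q) ^ 2 + 16 * (q + 1) ^ 2 = 0 := by
          linear_combination -r1
        nlinarith [sq_nonneg (q ^ 2 + 4 * q), sq_nonneg (q + 1)]
      · refine g1 (nsq 72 (nsq_of_lt 8 (by norm_num) (by norm_num) (by norm_num))
          (x := q ^ 2 + 4 * q + 4) (y := q) ?_).2
        push_cast
        linear_combination -r1

/-- x-coordinates of certain points of order 8 -/
def Ord8 {K : Type*} [Field K] (X : K) : Prop :=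
  ∃ j s : K, j ^ 2 = -1 ∧ s ^ 2 = 2 ∧ X ^ 2 + 4 * X = 4 * j * (X + 1)

theorem sq_eq_cases {K : Type*} [Field K] {a b : K} (h : a ^ 2 = b ^ 2) : a = b ∨ a = -b :=
  sq_eq_sq_iff_eq_or_eq_neg.mp h

theorem ord8_not_sq {K : Type*} [Field K] [CharZero K] (hK : SpanSJ K) {X q j s : K}
    (hj : j ^ 2 = -1) (hs : s ^ 2 = 2) (h : X ^ 2 + 4 * X = 4 * j * (X + 1)) (hq : X = q ^ 2) :
    False := by
  have h1 : (X + 2 - 2 * j) ^ 2 = (s * (1 - j)) ^ 2 := by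
    linear_combination h - (1 - j) ^ 2 * hs + 2 * hj
  rcases sq_eq_cases h1 with h2 | h2
  · exact norm_sixteen hK (s := -s) (j := j) (m := q) (by rw [neg_sq, hs]) hj
      (by linear_combination h2 - hq)
  · exact norm_sixteen hK (s := s) (j := j) (m := q) hs hj
      (by linear_combination h2 - hq)

section
variable {K : Type*} [Field K] [CharZero K]

theorem hits_H1 (hK : SpanSJ K) (no3 : ∀ j r : K, j ^ 2 = -1 → r ^ 2 = 3 → False)
    (no6 : ∀ t : K, t ^ 2 ≠ 6) {x : K} (hx : Hits 1 x) :
    ∀ y : K, y ^ 2 = x * (x + 1) * (x + 4) →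
      x = 0 ∨ x = -1 ∨ x = -4 ∨ x = 2 ∨ x = -2 ∨ Ord8 x := by
  induction hx with
  | root x hx =>
    intro y _
    rcases hx with h | h | h
    · left; exact h
    · right; left; linear_combination h
    · right; right; left; linear_combination h
  | step x h1 h2 h3 _ ih =>
    intro y hy
    have h3' : x + 4 ≠ 0 := by simpa using h3
    have hy0 : y ≠ 0 := by
      rintro rfl
      have : x * (x + 1) * (x + 4) ≠ 0 := by simp [h1, h2, h3']
      apply this; rw [← hy]; ring
    obtain ⟨q1, q2, q3⟩ := dupl_sq (ε := 1) (by norm_num) hy0 (by rw [hy]; ring)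
    obtain ⟨r1, r2, r3⟩ := dupl_rel (ε := 1) (by norm_num) h1 h2 h3
    generalize dupl 1 x = f at *
    generalize (x ^ 2 - 4) / (2 * y) = q at *
    generalize (x ^ 2 + 2 * 1 * x + 4) / (2 * y) = m at *
    generalize (x ^ 2 + 8 * 1 * x + 4) / (2 * y) = w at *
    have hc := ih (q * m * w) (by linear_combination (-m ^ 2 * w ^ 2) * q1 - f * w ^ 2 * q2 - f * (f + 1) * q3)
    rcases hc with rfl | rfl | rfl | rfl | rfl | hc
    · have : x ^ 2 - 4 = 0 := by
        refine pow_eq_zero_iff two_ne_zero |>.mp ?_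
        rw [← r1]; ring
      have : (x - 2) * (x + 2) = 0 := by linear_combination this
      rcases mul_eq_zero.mp this with h | h
      · right; right; right; left; linear_combination h
      · right; right; right; right; left; linear_combination h
    · exfalso
      have hq : x ^ 2 + 2 * x + 4 = 0 := by
        refine pow_eq_zero_iff two_ne_zero |>.mp ?_
        linear_combination -r2
      have hx0 : x ≠ 0 := h1
      have hR : (y / x) ^ 2 = 3 := by
        rw [div_pow, div_eq_iff (pow_ne_zero 2 hx0), hy]
        linear_combination x * hq
      have hR0 : y / x ≠ 0 := by
        intro h0; rw [h0] at hR; norm_num at hR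
      refine no3 ((x + 1) / (y / x)) (y / x) ?_ hR
      rw [div_pow, hR]
      linear_combination hq / 3
    · exfalso
      have hq : x ^ 2 + 8 * x + 4 = 0 := by
        refine pow_eq_zero_iff two_ne_zero |>.mp ?_
        linear_combination -r3
      have hR : ((x + 4) / 2) ^ 2 = 3 := by linear_combination hq / 4
      have hR0 : (x + 4) / 2 ≠ 0 := by
        intro h0; rw [h0] at hR; norm_num at hR
      refine no3 (y / (x * ((x + 4) / 2))) ((x + 4) / 2) ?_ hR
      rw [div_pow, mul_pow, hR, hy, div_eq_iff (by simp [h1])]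
      linear_combination x * hq
    · exfalso
      refine no6 (q * m) ?_
      rw [mul_pow, ← q1, ← q2]; norm_num
    · right; right; right; right; right
      have hj : ((x ^ 2 + 4 * x) / (4 * (x + 1))) ^ 2 = -1 := by
        rw [div_pow, div_eq_iff (by simp [h2])]
        linear_combination -r1
      refine ⟨(x ^ 2 + 4 * x) / (4 * (x + 1)), (x ^ 2 + 4 * x) / (4 * (x + 1)) * q, hj, ?_, ?_⟩
      · rw [mul_pow, hj, ← q1]; norm_num
      · field_simp
    · exfalso
      obtain ⟨j, s, hj, hs, h⟩ := hc
      exact ord8_not_sq hK hj hs h q1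

theorem hits_dbl (hK : SpanSJ K) (hR : SpanRW K)
    (no6 : ∀ t : K, t ^ 2 ≠ 6) {x : K} (hx : Hits (-1) x) :
    ∀ a b c : K, x = a ^ 2 → x - 1 = b ^ 2 → x - 4 = c ^ 2 →
      x = 0 ∨ x = 1 ∨ x = 4 ∨ (x = 2 ∧ ∃ j : K, j ^ 2 = -1) ∨
      ∃ r w : K, x = 4 + 2 * r ∧ r ^ 2 = 3 ∧ w ^ 2 = 2 * r := by
  induction hx with
  | root x hx =>
    intro a b c _ _ _
    rcases hx with h | h | h
    · left; exact h
    · right; left; linear_combination h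
    · right; right; left; linear_combination h
  | step x h1 h2 h3 _ ih =>
    intro a b c ha hb hc
    have ha0 : a ≠ 0 := by rintro rfl; apply h1; rw [ha]; ring
    have hb0 : b ≠ 0 := by rintro rfl; apply h2; linear_combination hb
    have hc0 : c ≠ 0 := by rintro rfl; apply h3; linear_combination hc
    obtain ⟨y, hyd⟩ : ∃ y, y = a * b * c := ⟨_, rfl⟩
    have hy0 : y ≠ 0 := by simp [hyd, ha0, hb0, hc0]
    have hy : y ^ 2 = x * (x + -1) * (x + 4 * -1) := by
      rw [hyd]; linear_combination -b ^ 2 * c ^ 2 * ha - x * c ^ 2 * hb - x * (x - 1) * hc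
    obtain ⟨q1, q2, q3⟩ := dupl_sq (ε := -1) (by norm_num) hy0 hy
    obtain ⟨r1, r2, r3⟩ := dupl_rel (ε := -1) (by norm_num) h1 h2 h3
    obtain ⟨q, hq⟩ : ∃ q, q = (x ^ 2 - 4) / (2 * y) := ⟨_, rfl⟩
    obtain ⟨m, hm⟩ : ∃ m, m = (x ^ 2 + 2 * -1 * x + 4) / (2 * y) := ⟨_, rfl⟩
    obtain ⟨w, hw⟩ : ∃ w, w = (x ^ 2 + 8 * -1 * x + 4) / (2 * y) := ⟨_, rfl⟩
    rw [← hq] at q1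
    rw [← hm] at q2
    rw [← hw] at q3
    rw [eq_div_iff (by simp [hy0])] at hq hm hw
    generalize dupl (-1) x = f at *
    rcases ih q m w q1 (by rw [← q2]; ring) (by rw [← q3]; ring) with
      rfl | rfl | rfl | ⟨rfl, hf⟩ | ⟨r, w', hr, hr3, hwr⟩
    · have : x ^ 2 - 4 = 0 := by
        refine pow_eq_zero_iff two_ne_zero |>.mp ?_
        rw [← r1]; ring
      have : (x - 2) * (x + 2) = 0 := by linear_combination this
      rcases mul_eq_zero.mp this with h | h
      · right; right; right; left
        refine ⟨by linear_combination h, c / a, ?_⟩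
        rw [div_pow, div_eq_iff (pow_ne_zero 2 ha0)]
        linear_combination -ha - hc + 2 * h
      · exfalso
        apply no6 (a * b)
        rw [mul_pow, ← ha, ← hb]
        linear_combination (x - 3) * h
    · exfalso
      have hq : x ^ 2 - 2 * x + 4 = 0 := by
        refine pow_eq_zero_iff two_ne_zero |>.mp ?_
        linear_combination -r2
      have h0 : 2 - x ≠ 0 := by
        intro h0
        have : (4 : K) = 0 := by linear_combination hq + x * h0
        norm_num at this
      apply no6 (2 * a * (x - 1) / (2 - x))
      rw [div_pow, div_eq_iff (pow_ne_zero 2 h0), mul_pow, mul_pow, ← ha]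
      linear_combination (4 * x - 6) * hq
    · right; right; right; right
      have hq : x ^ 2 - 8 * x + 4 = 0 := by
        refine pow_eq_zero_iff two_ne_zero |>.mp ?_
        linear_combination -r3
      refine ⟨(x - 4) / 2, c, by ring, ?_, ?_⟩
      · linear_combination hq / 4
      · rw [← hc]; ring
    · exfalso
      have h2' : x - 1 ≠ 0 := by simpa [sub_eq_add_neg] using h2
      have hj : ((x ^ 2 - 4 * x) / (4 * (x - 1))) ^ 2 = -1 := by
        rw [div_pow, div_eq_iff (by simp [h2'])]
        linear_combination -r1
      obtain ⟨j, hjd⟩ : ∃ j, j = (x ^ 2 - 4 * x) / (4 * (x - 1)) := ⟨_, rfl⟩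
      rw [← hjd] at hj
      rw [eq_div_iff (by simp [h2'])] at hjd
      refine ord8_not_sq hK (X := -x) (q := j * a) (j := -j) (s := q) (by rw [neg_sq, hj]) q1.symm ?_ ?_
      · linear_combination -hjd
      · rw [mul_pow, hj, ← ha]; ring
    · exfalso
      have e1 : q ^ 2 = (1 + r) ^ 2 := by linear_combination hr - q1 - hr3
      have e3 : w ^ 2 = 2 * r := by linear_combination hr - q3
      have e2 : m ^ 2 = (w * (1 + r) / 2) ^ 2 := by
        linear_combination hr - q2 - (1 + r) ^ 2 / 4 * e3 - (r + 2) / 2 * hr3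
      have hb2 : b ^ 2 = (m + w) * (m + q) := by
        have hyy : (2 * y) ^ 2 ≠ 0 := by simp [hy0]
        apply mul_right_cancel₀ hyy
        rw [show (m + w) * (m + q) * (2 * y) ^ 2 = (m * (2 * y) + w * (2 * y)) * (m * (2 * y) + q * (2 * y)) by ring,
          hm, hq, hw, ← hb]
        linear_combination 4 * (x - 1) * hy
      rcases sq_eq_cases e1 with rfl | rfl <;> rcases sq_eq_cases e2 with rfl | rfl
      · obtain ⟨t, ht⟩ := norm_rw_two hR (m := b) hr3 e3 (u := 6) (v := 3) (u' := 3) (v' := 2)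
          (x := -9) (y := -6) (by rw [hb2]; push_cast; linear_combination ((1 + r) ^ 2 / 4 + (1 + r) / 2) * e3 + (r / 2 + 2 + w / 2) * hr3) (by norm_num) (by norm_num)
        nlinarith [sq_nonneg t]
      · obtain ⟨t, ht⟩ := norm_rw_two hR (m := b) hr3 e3 (u := 0) (v := 1) (u' := -1) (v' := 0)
          (x := 3) (y := -2) (by rw [hb2]; push_cast; linear_combination ((1 + r) ^ 2 / 4 - (1 + r) / 2) * e3 + (r / 2  - w / 2) * hr3) (by norm_num) (by norm_num)
        nlinarith [sq_nonneg t]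
      · obtain ⟨t, ht⟩ := norm_rw_two hR (m := b) hr3 e3 (u := 6) (v := 3) (u' := -3) (v' := -2)
          (x := -9) (y := -6) (by rw [hb2]; push_cast; linear_combination ((1 + r) ^ 2 / 4 + (1 + r) / 2) * e3 + (r / 2 + 2 - w / 2) * hr3) (by norm_num) (by norm_num)
        nlinarith [sq_nonneg t]
      · obtain ⟨t, ht⟩ := norm_rw_two hR (m := b) hr3 e3 (u := 0) (v := 1) (u' := 1) (v' := 0)
          (x := 3) (y := -2) (by rw [hb2]; push_cast; linear_combination ((1 + r) ^ 2 / 4 - (1 + r) / 2) * e3 + (r / 2 + w / 2) * hr3) (by norm_num) (by norm_num)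
        nlinarith [sq_nonneg t]

end

/-- the arithmetic facts about `K` used in the main argument -/
structure Good (K : Type*) [Field K] [CharZero K] : Prop where
  H1 : ∀ X Y : K, Y ^ 2 = X * (X + 1) * (X + 4) →
    X = 0 ∨ X = -1 ∨ X = -4 ∨ X = 2 ∨ X = -2 ∨ Ord8 X
  span : SpanSJ K
  no3 : ∀ j r : K, j ^ 2 = -1 → r ^ 2 = 3 → False
  no5 : ∀ t : K, t ^ 2 ≠ 5
  nom5 : ∀ t : K, t ^ 2 ≠ -5
  G3 : ∀ u p q m : K, u ^ 2 - 1 = p ^ 2 → u ^ 2 - 4 = q ^ 2 →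
    ((u - 2) * (u - 1) = m ^ 2 ∨ u * (u + 1) = m ^ 2) →
    u = 0 ∨ u = 1 ∨ u = -1 ∨ u = 2 ∨ u = -2

theorem good_of_condB {K : Type*} [Field K] [NumberField K]
    (hKcyc : ¬ IsCyclotomicExtension {12} ℚ K) (h : condB K) : Good K := by
  obtain ⟨hf, hf', hn⟩ := h
  have hK := spanSJ_of_deg hn
  have hR := spanRW_of_deg hn
  have no3 : ∀ j r : K, j ^ 2 = -1 → r ^ 2 = 3 → False :=
    fun j r hj hr => hKcyc (cyclo_of_deg hn hj hr)
  have no6 : ∀ t : K, t ^ 2 ≠ 6 := by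
    intro t ht
    have h1 := hits_pos hn hf (-3) t (by rw [ht]; norm_num)
    have h2 := hits_rat (e := 1) (by norm_num) (by simpa using h1) (-3) (by norm_num)
    norm_num at h2
  refine ⟨fun X Y hXY => hits_H1 hK no3 no6 (hits_pos hn hf X Y hXY) Y hXY, hK, no3, ?_, ?_, ?_⟩
  · intro t ht
    have h1 := hits_neg hn hf' (1 / 4) (3 * t / 8) (by rw [div_pow, mul_pow, ht]; norm_num)
    have h2 := hits_rat (e := -1) (by norm_num) (by simpa using h1) (1 / 4) (by norm_num)
    norm_num at h2
  · intro t ht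
    have h1 := hits_pos hn hf (-5) (2 * t) (by rw [mul_pow, ht]; norm_num)
    have h2 := hits_rat (e := 1) (by norm_num) (by simpa using h1) (-5) (by norm_num)
    norm_num at h2
  · intro u p q m hp hq hm
    have h1 := hits_neg hn hf' (u ^ 2) (u * p * q) (by rw [hp, hq]; ring)
    rcases hits_dbl hK hR no6 h1 u p q rfl hp hq with h | h | h | ⟨h, j, hj⟩ | ⟨r, w, h, hr, hw⟩
    · left; exact pow_eq_zero_iff two_ne_zero |>.mp h
    · rcases sq_eq_cases (a := u) (b := 1) (by rw [h]; norm_num) with h | h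
      · right; left; exact h
      · right; right; left; exact h
    · rcases sq_eq_cases (a := u) (b := 2) (by rw [h]; norm_num) with h | h
      · right; right; right; left; exact h
      · right; right; right; right; exact h
    · exfalso
      rcases hm with hm | hm
      · obtain ⟨t, ht⟩ := norm_one hK h hj (m := m) (u := 4) (v := -3)
          (by rw [← hm]; push_cast; linear_combination h)
        nlinarith [sq_nonneg t]
      · obtain ⟨t, ht⟩ := norm_one hK h hj (m := m) (u := 2) (v := 1)
          (by rw [← hm]; push_cast; linear_combination h)
        exact nsq' 2 nsq2 t (by rw [ht]; norm_num)
    · exfalso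
      have n6 : ¬ IsSquare (6 : ℤ) := nsq_of_lt 2 (by norm_num) (by norm_num) (by norm_num)
      rcases sq_eq_cases (a := u) (b := 1 + r) (by rw [h]; linear_combination -hr) with rfl | rfl <;>
        rcases hm with hm | hm
      · obtain ⟨t, ht | ht⟩ := norm_rw_one hR (m := m) hr hw (u := 3) (v := -1)
          (by rw [← hm]; push_cast; linear_combination hr)
        · exact nsq' 6 n6 t (by rw [ht]; norm_num)
        · nlinarith [sq_nonneg t]
      · obtain ⟨t, ht | ht⟩ := norm_rw_one hR (m := m) hr hw (u := 5) (v := 3)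
          (by rw [← hm]; push_cast; linear_combination hr)
        · nlinarith [sq_nonneg t]
        · exact nsq' 24 (nsq_of_lt 4 (by norm_num) (by norm_num) (by norm_num)) t
            (by rw [ht]; norm_num)
      · obtain ⟨t, ht | ht⟩ := norm_rw_one hR (m := m) hr hw (u := 9) (v := 5)
          (by rw [← hm]; push_cast; linear_combination hr)
        · exact nsq' 6 n6 t (by rw [ht]; norm_num)
        · nlinarith [sq_nonneg t]
      · obtain ⟨t, ht | ht⟩ := norm_rw_one hR (m := m) hr hw (u := 3) (v := 1)
          (by rw [← hm]; push_cast; linear_combination hr)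
        · exact nsq' 6 n6 t (by rw [ht]; norm_num)
        · nlinarith [sq_nonneg t]

theorem good_of_condA {K : Type*} [Field K] [CharZero K] (h : condA K) : Good K := by
  obtain ⟨_, h1m, _, h6, h6m⟩ := h
  have noI : ∀ j : K, j ^ 2 ≠ -1 := by
    intro j hj
    obtain ⟨q, rfl⟩ := (h1m (-1) j (by rw [hj]; norm_num)).2
    have : q ^ 2 = -1 := by exact_mod_cast hj
    nlinarith [sq_nonneg q]
  have E6 : ∀ X Y : K, Y ^ 2 = X * (X + 1) * (X + 4) →
      X = 0 ∨ X = -1 ∨ X = -4 ∨ X = 2 ∨ X = -2 := by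
    intro X Y hXY
    obtain ⟨⟨x, hx⟩, y, rfl⟩ := h6 (X + 2) Y (by rw [hXY]; ring)
    obtain rfl : X = ((x - 2 : ℚ) : K) := by push_cast; rw [hx]; ring
    have := E6_rat (X := x - 2) (Y := y) (by exact_mod_cast hXY)
    exact_mod_cast this
  have E6m : ∀ X Y : K, Y ^ 2 = X * (X - 1) * (X - 4) → X = 0 ∨ X = 1 ∨ X = 4 := by
    intro X Y hXY
    obtain ⟨⟨x, hx⟩, y, rfl⟩ := h6m (X - 2) Y (by rw [hXY]; ring)
    obtain rfl : X = ((x + 2 : ℚ) : K) := by push_cast; rw [hx]; ring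
    have := E6m_rat (X := x + 2) (Y := y) (by exact_mod_cast hXY)
    exact_mod_cast this
  refine ⟨?_, fun j s hj => absurd hj (noI j), fun j r hj => absurd hj (noI j), ?_, ?_, ?_⟩
  · intro X Y hXY
    rcases E6 X Y hXY with h | h | h | h | h <;> simp [h]
  · intro t ht
    have h1 := E6m (1 / 4) (3 * t / 8) (by rw [div_pow, mul_pow, ht]; norm_num)
    norm_num at h1
  · intro t ht
    have h1 := E6 (-5) (2 * t) (by rw [mul_pow, ht]; norm_num)
    norm_num at h1
  · intro u p q m hp hq _
    rcases E6m (u ^ 2) (u * p * q) (by rw [hp, hq]; ring) with h | h | h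
    · left; exact pow_eq_zero_iff two_ne_zero |>.mp h
    · rcases sq_eq_cases (a := u) (b := 1) (by rw [h]; norm_num) with h | h
      · right; left; exact h
      · right; right; left; exact h
    · rcases sq_eq_cases (a := u) (b := 2) (by rw [h]; norm_num) with h | h
      · right; right; right; left; exact h
      · right; right; right; right; exact h

section
variable {K : Type*} [Field K] [CharZero K]

theorem four_terms (hG : Good K) {δ g h A1 A2 A4 B1 B2 B4 : K} (hδ : δ ≠ 0) (hh : h ≠ 0)
    (p1 : A1 * B1 = -2 * h) (p2 : A2 * B2 = -h) (p4 : A4 * B4 = h)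
    (s1 : A1 ^ 2 + δ * B1 ^ 2 = 1 - 2 * g) (s2 : A2 ^ 2 + δ * B2 ^ 2 = 1 - g)
    (s4 : A4 ^ 2 + δ * B4 ^ 2 = 1 + g) :
    g ^ 2 - 4 * δ * h ^ 2 = 2 * g ∨ (∃ j s : K, j ^ 2 = -1 ∧ s ^ 2 = 2) ∧
      4 * g = 2 + 2 * (g ^ 2 - 4 * δ * h ^ 2) + (g ^ 2 - 4 * δ * h ^ 2) ^ 2 := by
  have hB1 : B1 ≠ 0 := by rintro rfl; apply hh; linear_combination p1 / 2
  have hB2 : B2 ≠ 0 := by rintro rfl; apply hh; linear_combination p2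
  have hB4 : B4 ≠ 0 := by rintro rfl; apply hh; linear_combination -p4
  obtain ⟨n1, d1⟩ : ∃ n, n = A1 ^ 2 - δ * B1 ^ 2 := ⟨_, rfl⟩
  obtain ⟨n2, d2⟩ : ∃ n, n = A2 ^ 2 - δ * B2 ^ 2 := ⟨_, rfl⟩
  obtain ⟨n4, d4⟩ : ∃ n, n = A4 ^ 2 - δ * B4 ^ 2 := ⟨_, rfl⟩
  obtain ⟨G, hGd⟩ : ∃ G, G = g ^ 2 - 4 * δ * h ^ 2 := ⟨_, rfl⟩
  rw [← hGd]
  have q1 : n1 ^ 2 = 1 - 4 * g + 4 * G := by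
    rw [d1, hGd]
    linear_combination (A1 ^ 2 + δ * B1 ^ 2 + 1 - 2 * g) * s1 - 4 * δ * (A1 * B1 - 2 * h) * p1
  have q2 : n2 ^ 2 = 1 - 2 * g + G := by
    rw [d2, hGd]
    linear_combination (A2 ^ 2 + δ * B2 ^ 2 + 1 - g) * s2 - 4 * δ * (A2 * B2 - h) * p2
  have q4 : n4 ^ 2 = 1 + 2 * g + G := by
    rw [d4, hGd]
    linear_combination (A4 ^ 2 + δ * B4 ^ 2 + 1 + g) * s4 - 4 * δ * (A4 * B4 + h) * p4
  have a1 : 2 * A1 ^ 2 = 1 - 2 * g + n1 := by linear_combination s1 - d1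
  have a2 : 2 * A2 ^ 2 = 1 - g + n2 := by linear_combination s2 - d2
  have a4 : 2 * A4 ^ 2 = 1 + g + n4 := by linear_combination s4 - d4
  have b1 : 2 * δ * B1 ^ 2 = 1 - 2 * g - n1 := by linear_combination s1 + d1
  have b2 : 2 * δ * B2 ^ 2 = 1 - g - n2 := by linear_combination s2 + d2
  have b4 : 2 * δ * B4 ^ 2 = 1 + g - n4 := by linear_combination s4 + d4
  obtain ⟨D1, e1⟩ : ∃ D, D = n1 - 2 * n2 + 1 := ⟨_, rfl⟩
  obtain ⟨D2, e2⟩ : ∃ D, D = n2 - 2 + n4 := ⟨_, rfl⟩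
  have hδ2 : 2 * δ ≠ 0 := by simp [hδ]
  have z1 : D1 ≠ 0 := by
    intro h0
    have u1 : A1 ^ 2 - 2 * A2 ^ 2 + 1 = 0 := by
      linear_combination a1 / 2 - a2 - e1 / 2 + h0 / 2
    have u2 : B1 ^ 2 = 2 * B2 ^ 2 := by
      apply mul_left_cancel₀ hδ2
      linear_combination b1 - 2 * b2 + e1 - h0
    have u3 : A1 ^ 2 = 2 * A2 ^ 2 := by
      apply mul_right_cancel₀ (pow_ne_zero 2 hB1)
      linear_combination (A1 * B1 + 2 * (A2 * B2)) * (p1 - 2 * p2) - 2 * A2 ^ 2 * u2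
    exact one_ne_zero (α := K) (by linear_combination u1 - u3)
  have z2 : D2 ≠ 0 := by
    intro h0
    have u1 : A2 ^ 2 + A4 ^ 2 = 2 := by
      linear_combination a2 / 2 + a4 / 2 - e2 / 2 + h0 / 2
    have u2 : B4 ^ 2 = -B2 ^ 2 := by
      apply mul_left_cancel₀ hδ2
      linear_combination b2 + b4 + e2 - h0
    have u3 : A4 ^ 2 = -A2 ^ 2 := by
      apply mul_right_cancel₀ (pow_ne_zero 2 hB4)
      linear_combination (A4 * B4 - (A2 * B2)) * (p4 + p2) + A2 ^ 2 * u2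
    exact two_ne_zero (α := K) (by linear_combination u3 - u1)
  have z3 : D1 + 2 * D2 ≠ 0 := by
    intro h0
    have u1 : A1 ^ 2 + 2 * A4 ^ 2 = 3 := by
      linear_combination a1 / 2 + a4 - e1 / 2 - e2 + h0 / 2
    have u2 : B1 ^ 2 = -2 * B4 ^ 2 := by
      apply mul_left_cancel₀ hδ2
      linear_combination b1 + 2 * b4 + e1 + 2 * e2 - h0
    have u3 : A1 ^ 2 = -2 * A4 ^ 2 := by
      apply mul_right_cancel₀ (pow_ne_zero 2 hB1)
      linear_combination (A1 * B1 - 2 * (A4 * B4)) * (p1 + 2 * p4) + 2 * A4 ^ 2 * u2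
    exact three_ne_zero (by linear_combination u3 - u1 : (3 : K) = 0)
  have z4 : D2 + 2 * D1 ≠ 0 := by
    intro h0
    have u1 : 3 * A2 ^ 2 = 2 * A1 ^ 2 + A4 ^ 2 := by
      linear_combination -a1 - a4 / 2 + 3 / 2 * a2 + e1 + e2 / 2 - h0 / 2
    have u2 : 3 * B2 ^ 2 = 2 * B1 ^ 2 + B4 ^ 2 := by
      apply mul_left_cancel₀ hδ2
      linear_combination 3 * b2 - 2 * b1 - b4 - 2 * e1 - e2 + h0
    have v1 : A1 ^ 2 * B1 ^ 2 = 4 * h ^ 2 := by linear_combination (A1 * B1 - 2 * h) * p1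
    have v2 : A2 ^ 2 * B2 ^ 2 = h ^ 2 := by linear_combination (A2 * B2 - h) * p2
    have v4 : A4 ^ 2 * B4 ^ 2 = h ^ 2 := by linear_combination (A4 * B4 + h) * p4
    have w : A1 ^ 2 * B4 ^ 2 + A4 ^ 2 * B1 ^ 2 = -4 * h ^ 2 := by
      linear_combination 9 / 2 * v2 - 2 * v1 - v4 / 2 - 3 / 2 * B2 ^ 2 * u1
        - (2 * A1 ^ 2 + A4 ^ 2) / 2 * u2
    have w2 : (A1 ^ 2 * B4 ^ 2 + 2 * h ^ 2) ^ 2 = 0 := by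
      linear_combination A1 ^ 2 * B4 ^ 2 * w - A4 ^ 2 * B4 ^ 2 * v1 - 4 * h ^ 2 * v4
    have w3 := pow_eq_zero_iff two_ne_zero |>.mp w2
    have w4 : A1 ^ 2 = -2 * A4 ^ 2 := by
      apply mul_right_cancel₀ (pow_ne_zero 2 hB4)
      linear_combination w3 + 2 * v4
    have w5 : B1 ^ 2 = -2 * B4 ^ 2 := by
      have hA4 : A4 ≠ 0 := by rintro rfl; apply hh; linear_combination -p4
      apply mul_left_cancel₀ (pow_ne_zero 2 hA4)
      linear_combination w - w3 + 2 * v4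
    exact three_ne_zero (by linear_combination w4 + δ * w5 - s1 - 2 * s4 : (3 : K) = 0)
  have lin : 3 * (n2 - 1) * (D1 + D2) + (D1 - D2) * (n2 + 1 + D1 + D2) = 0 := by
    rw [e1, e2]
    linear_combination q1 - 3 * q2 - q4
  obtain ⟨p, hp⟩ : ∃ p, D2 = p * D1 := ⟨D2 / D1, by field_simp⟩
  have hcur : (2 * D2 * (-(D1 + 2 * D2)) * (A1 * B2 - A2 * B1) / (B4 * D1 ^ 2)) ^ 2 =
      (2 * p) * (2 * p + 1) * (2 * p + 4) := by
    rw [div_pow, div_eq_iff (by simp [hB4, z1])]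
    have cA : D2 * A1 ^ 2 - (D1 + 2 * D2) * A2 ^ 2 + (D2 + 2 * D1) - D1 * A4 ^ 2 = 0 := by
      rw [e1, e2]
      linear_combination (n2 - 2 + n4) / 2 * a1 - (n1 - 2 * n2 + 1 + 2 * (n2 - 2 + n4)) / 2 * a2
        - (n1 - 2 * n2 + 1) / 2 * a4
    have cB : D2 * B1 ^ 2 - (D1 + 2 * D2) * B2 ^ 2 - D1 * B4 ^ 2 = 0 := by
      apply mul_left_cancel₀ hδ2
      rw [e1, e2]
      linear_combination (n2 - 2 + n4) * b1 - (n1 - 2 * n2 + 1 + 2 * (n2 - 2 + n4)) * b2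
        - (n1 - 2 * n2 + 1) * b4
    have cC : D2 * (A1 * B1) - (D1 + 2 * D2) * (A2 * B2) - D1 * (A4 * B4) = 0 := by
      rw [p1, p2, p4]; ring
    have key : -D2 * (D1 + 2 * D2) * (A1 * B2 - A2 * B1) ^ 2 = -(D2 + 2 * D1) * D1 * B4 ^ 2 := by
      linear_combination (D2 * B1 ^ 2 - (D1 + 2 * D2) * B2 ^ 2) * cA
        - (D2 + 2 * D1 - D1 * A4 ^ 2) * cB
        - (D2 * (A1 * B1) - (D1 + 2 * D2) * (A2 * B2) + D1 * (A4 * B4)) * cC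
    have key2 := congrArg (fun t => -4 * D2 * (D1 + 2 * D2) * t) key
    rw [hp] at key2 ⊢
    linear_combination key2
  have hp0 : p ≠ 0 := by rintro rfl; apply z2; rw [hp]; ring
  rcases hG.H1 _ _ hcur with h1 | h1 | h1 | h1 | h1 | ⟨j, s, hj, hs, h1⟩
  · exact absurd h1 (by simp [hp0])
  · exact absurd (by rw [hp]; linear_combination D1 * h1) z3
  · exact absurd (by rw [hp]; linear_combination D1 * h1 / 2) z4
  · left
    have hp1 : p = 1 := by linear_combination h1 / 2
    rw [hp1, one_mul] at hp
    rw [hp] at lin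
    have : D1 * (n2 - 1) = 0 := by linear_combination lin / 6
    have : n2 - 1 = 0 := (mul_eq_zero.mp this).resolve_left z1
    linear_combination (n2 + 1) * this - q2
  · left
    have hp1 : p = -1 := by linear_combination h1 / 2
    rw [hp1] at hp
    rw [hp] at lin
    have : D1 * (n2 + 1) = 0 := by linear_combination lin / 2
    have : n2 + 1 = 0 := (mul_eq_zero.mp this).resolve_left z1
    linear_combination (n2 - 1) * this - q2
  · right
    refine ⟨⟨j, s, hj, hs⟩, ?_⟩
    have h2 : p ^ 2 + 2 * p = j * (2 * p + 1) := by linear_combination h1 / 4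
    have hq : 2 * p + 1 ≠ 0 := by
      intro h0
      have : p * (p + 2) = 0 := by linear_combination h2 + j * h0
      rcases mul_eq_zero.mp this with h | h
      · exact hp0 h
      · exact three_ne_zero (by linear_combination 2 * h - h0 : (3 : K) = 0)
    have lin2 : 3 * (n2 - 1) * (1 + p) + (1 - p) * (n2 + 1 + D1 + D2) = 0 := by
      apply mul_left_cancel₀ z1
      linear_combination lin + (-3 * (n2 - 1) + (n2 + 1 + D1 + D2)) * hp
    have r1 : (1 - p ^ 2) * n4 = 2 * (1 + p + p ^ 2) - (1 + 4 * p + p ^ 2) * n2 := by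
      linear_combination p * lin2 + (-(1 - p ^ 2)) * e2 + (1 - p ^ 2 - p * (1 - p)) * hp
    have r2 : (2 * p + 1) * (n4 + j * n2) = (1 + p + p ^ 2) * (1 + j) := by
      linear_combination (1 + j) / 2 * r1 + (1 + j) / 2 * (n4 - n2) * h2
        + (2 * p + 1) / 2 * (n4 - n2) * hj
    have r3 : (1 + p + p ^ 2) ^ 2 = -j * (2 * p + 1) ^ 2 := by
      linear_combination (p ^ 2 + 2 * p + j * (2 * p + 1) - (2 * p + 1)) * h2 + (2 * p + 1) ^ 2 * hj
    have r4 : (n4 + j * n2) ^ 2 = 2 := by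
      apply mul_left_cancel₀ (pow_ne_zero 2 hq)
      linear_combination ((2 * p + 1) * (n4 + j * n2) + (1 + p + p ^ 2) * (1 + j)) * r2
        + (1 + j) ^ 2 * r3 - (2 * p + 1) ^ 2 * (2 + j) * hj
    have r5 : n4 ^ 2 + n2 ^ 2 - 2 = -2 * (n4 + j * n2) * j * n2 := by
      linear_combination r4 + n2 ^ 2 * hj
    have r6 : (n4 ^ 2 + n2 ^ 2 - 2) ^ 2 = -8 * n2 ^ 2 := by
      rw [r5]; linear_combination 4 * j ^ 2 * n2 ^ 2 * r4 + 8 * n2 ^ 2 * hj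
    rw [q4, q2] at r6
    linear_combination -r6 / 4

theorem mixed_case (hG : Good K) {δ g h A B j : K} (hδ : δ ≠ 0) (hh : h ≠ 0) (hj : j ^ 2 = -1)
    (p : A * B = -h) (s : A ^ 2 + δ * B ^ 2 = 1 - g)
    (h1 : g ^ 2 - 4 * δ * h ^ 2 = 2 * g)
    (h2 : -4 * g = 2 + 2 * (g ^ 2 - 4 * δ * h ^ 2) + (g ^ 2 - 4 * δ * h ^ 2) ^ 2) : False := by
  rw [h1] at h2
  have hs : (2 * g + 2) ^ 2 = 2 := by linear_combination -h2
  have hg : g ≠ 0 := by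
    rintro rfl
    norm_num at hs
  have hPQ : (A * g - 2 * h * δ * B) * (g * B - 2 * h * A) = 0 := by
    linear_combination (g ^ 2 + 4 * h ^ 2 * δ) * p - 2 * h * g * s + h * h1
  have hsum : (A * g - 2 * h * δ * B) ^ 2 + δ * (g * B - 2 * h * A) ^ 2 = -2 * g := by
    linear_combination (g ^ 2 + 4 * δ * h ^ 2) * s - 8 * h * g * δ * p + (-1 - g) * h1
  rcases mul_eq_zero.mp hPQ with h0 | h0
  · rw [h0] at hsum
    have e : (4 * δ * h * (g * B - 2 * h * A) / (2 * g)) ^ 2 = 4 - 2 * g := by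
      rw [div_pow, div_eq_iff (by simp [hg])]
      linear_combination 16 * δ * h ^ 2 * hsum + 8 * g * h1
    obtain ⟨t, ht⟩ := norm_one hG.span hs hj (u := 6) (v := -1)
      (by rw [e]; push_cast; ring)
    exact nsq' 34 (nsq_of_lt 5 (by norm_num) (by norm_num) (by norm_num)) t (by rw [ht]; norm_num)
  · rw [h0] at hsum
    obtain ⟨t, ht⟩ := norm_one hG.span hs hj (m := A * g - 2 * h * δ * B) (u := 2) (v := -1)
      (by push_cast; linear_combination hsum)
    exact nsq' 2 nsq2 t (by rw [ht]; norm_num)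

theorem h_eq_zero (hG : Good K) {δ g h A1 A2 A4 A5 B1 B2 B4 B5 : K} (hδ : δ ≠ 0)
    (p1 : A1 * B1 = -2 * h) (p2 : A2 * B2 = -h) (p4 : A4 * B4 = h) (p5 : A5 * B5 = 2 * h)
    (s1 : A1 ^ 2 + δ * B1 ^ 2 = 1 - 2 * g) (s2 : A2 ^ 2 + δ * B2 ^ 2 = 1 - g)
    (s4 : A4 ^ 2 + δ * B4 ^ 2 = 1 + g) (s5 : A5 ^ 2 + δ * B5 ^ 2 = 1 + 2 * g) : h = 0 := by
  by_contra hh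
  have f := four_terms hG hδ hh p1 p2 p4 s1 s2 s4
  have f' := four_terms hG (g := -g) (h := -h) (A1 := A5) (A2 := A4) (A4 := A2)
    (B1 := B5) (B2 := B4) (B4 := B2) hδ (neg_ne_zero.mpr hh) (by rw [p5]; ring) (by rw [p4]; ring)
    p2 (by rw [s5]; ring) (by rw [s4]; ring) (by rw [s2]; ring)
  simp only [neg_sq] at f'
  rcases f with f | ⟨⟨j, s, hj, hs⟩, f⟩ <;> rcases f' with f' | ⟨⟨j', s', hj', hs'⟩, f'⟩
  · have hg : g = 0 := by linear_combination (f' - f) / 4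
    rw [hg] at f
    have : δ * h ^ 2 = 0 := by linear_combination -f / 4
    simp [hδ, hh] at this
  · exact mixed_case hG hδ hh hj' p2 s2 f (by linear_combination f')
  · exact mixed_case hG (g := -g) (h := -h) (A := A4) (B := B4) hδ (neg_ne_zero.mpr hh) hj
      (by rw [p4]; ring) (by rw [s4]; ring) (by linear_combination f') (by linear_combination f)
  · have hg : g = 0 := by linear_combination (f - f') / 8
    rw [hg] at f s2
    have hJ : (1 - 4 * δ * h ^ 2) ^ 2 = -1 := by linear_combination -f
    have hz : (2 * A2 ^ 2 - 1) ^ 2 = 1 - 4 * δ * h ^ 2 := by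
      linear_combination 4 * A2 ^ 2 * s2 - 4 * δ * (A2 * B2 - h) * p2
    obtain ⟨J, hJd⟩ : ∃ J, J = 1 - 4 * δ * h ^ 2 := ⟨_, rfl⟩
    obtain ⟨z, hzd⟩ : ∃ z, z = 2 * A2 ^ 2 - 1 := ⟨_, rfl⟩
    rw [← hJd] at hJ hz
    rw [← hzd] at hz
    have hz0 : z ≠ 0 := by
      rintro rfl
      have : J = 0 := by rw [← hz]; ring
      rw [this] at hJ
      norm_num at hJ
    have hs2 : ((1 + J) / z) ^ 2 = 2 := by
      rw [div_pow, hz, div_eq_iff (by rw [← hz]; exact pow_ne_zero 2 hz0)]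
      linear_combination hJ
    have hzs : (1 + J) / z * z = 1 + J := by field_simp
    obtain ⟨S, hS⟩ : ∃ S, S = (1 + J) / z := ⟨_, rfl⟩
    rw [← hS] at hs2 hzs
    obtain ⟨t, ht⟩ := norm_two hG.span (m := 2 * A2) hs2 hJ (u := 2) (v := 1) (u' := 0) (v' := 1)
      (by push_cast; linear_combination S * hzs - z * hs2 - 2 * hzd)
    exact nsq' 32 (nsq_of_lt 5 (by norm_num) (by norm_num) (by norm_num)) t (by rw [ht]; norm_num)

end

section
variable {K : Type*} [Field K] [CharZero K]

/-- `c` is a square, or `δ` times a square -/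
def Cls (δ c : K) : Prop := (∃ k, c = k ^ 2) ∨ ∃ k, c = δ * k ^ 2

theorem even_case (hG : Good K) {δ g y : K} (hg : g ≠ 0) (z1 : 1 - 2 * g ≠ 0) (z2 : 1 - g ≠ 0)
    (z4 : 1 + g ≠ 0) (k2 : Cls δ (1 - g)) (k4 : Cls δ (1 + g))
    (k5 : Cls δ (1 + 2 * g)) (hy : (1 - 2 * g) * (1 - g) * (1 + g) = y ^ 2) : False := by
  obtain ⟨u, hu⟩ : ∃ u, u * g = 1 := ⟨g⁻¹, by field_simp⟩
  have hu0 : u ≠ 0 := by rintro rfl; simp at hu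
  have f1 : u - 2 = u * (1 - 2 * g) := by linear_combination 2 * hu
  have f2 : u - 1 = u * (1 - g) := by linear_combination hu
  have f4 : u + 1 = u * (1 + g) := by linear_combination -hu
  have f5 : u + 2 = u * (1 + 2 * g) := by linear_combination -2 * hu
  have hy' : (u - 2) * (u - 1) * u * (u + 1) = (u ^ 2 * y) ^ 2 := by
    rw [f1, f2, f4]; linear_combination u ^ 4 * hy
  have hne : (u - 2) * (u - 1) * u * (u + 1) ≠ 0 := by
    rw [f1, f2, f4]; simp [hu0, z1, z2, z4]
  obtain ⟨z, hz⟩ : ∃ z, z = u ^ 2 * y + (u ^ 2 - u - 1) := ⟨_, rfl⟩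
  have hzq : z ^ 2 + 1 = 2 * z * (u ^ 2 - u - 1) := by
    rw [hz]; linear_combination -hy'
  have hcur : (2 * z * (2 * u - 1)) ^ 2 = (2 * z) * (2 * z + 1) * (2 * z + 4) := by
    linear_combination -8 * z * hzq
  -- the case `u = 1 / 2`
  have half : 2 * u - 1 = 0 → False := by
    intro h0
    have hg2 : g = 2 := by linear_combination 2 * hu - g * h0
    subst hg2
    rcases k5 with ⟨k, hk⟩ | ⟨k, hk⟩
    · exact hG.no5 k (by rw [← hk]; norm_num)
    rcases k2 with ⟨j, hj⟩ | ⟨k', hk'⟩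
    · have hj1 : j ^ 2 = -1 := by rw [← hj]; norm_num
      rcases k4 with ⟨r, hr⟩ | ⟨k', hk'⟩
      · exact hG.no3 j r hj1 (by rw [← hr]; norm_num)
      · obtain ⟨r, hrd⟩ : ∃ r, r = j * (δ * k * k') := ⟨_, rfl⟩
        have hr : r ^ 2 = -15 := by
          rw [hrd]
          linear_combination δ ^ 2 * k ^ 2 * k' ^ 2 * hj1 + δ * k' ^ 2 * hk + 5 * hk'
        obtain ⟨X, hXd⟩ : ∃ X, X = (r - 1) / 2 := ⟨_, rfl⟩
        have hX : X ^ 2 + X + 4 = 0 := by rw [hXd]; linear_combination hr / 4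
        rcases hG.H1 X (2 * X) (by linear_combination (-X) * hX) with
          h | h | h | h | h | ⟨j', s', hj', _, h⟩
        · rw [h] at hX; norm_num at hX
        · rw [h] at hX; norm_num at hX
        · rw [h] at hX; norm_num at hX
        · rw [h] at hX; norm_num at hX
        · rw [h] at hX; norm_num at hX
        · have : X = -4 := by
            have e : 3 * X - 4 = 4 * j' * (X + 1) := by linear_combination h - hX
            have e2 : 17 * (X + 4) = 0 := by
              linear_combination (-(3 * X - 4) - 4 * j' * (X + 1)) * e - 16 * (X + 1) ^ 2 * hj'
                + 25 * hX
            have e3 : X + 4 = 0 := (mul_eq_zero.mp e2).resolve_left (by norm_num)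
            linear_combination e3
          rw [this] at hX; norm_num at hX
    · exact hG.nom5 (δ * k * k') (by linear_combination -δ * k' ^ 2 * hk - 5 * hk')
  have hz0 : z ≠ 0 := by
    intro h0
    rw [h0] at hzq
    norm_num at hzq
  have halfsq : z * (2 * u - 1) ^ 2 = (2 * z + 1) * (z + 2) := by linear_combination -2 * hzq
  have h12 : (2 * u - 1) ^ 2 = 0 → False := fun h => half (pow_eq_zero_iff two_ne_zero |>.mp h)
  rcases hG.H1 _ _ hcur with h1 | h1 | h1 | h1 | h1 | ⟨j, s0, hj, hs0, h1⟩
  · exact hz0 (by linear_combination h1 / 2)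
  · apply h12
    apply mul_left_cancel₀ hz0
    linear_combination halfsq + (z + 2) * h1
  · apply h12
    apply mul_left_cancel₀ hz0
    linear_combination halfsq + (2 * z + 1) / 2 * h1
  · apply hne
    have hz1 : z = 1 := by linear_combination h1 / 2
    rw [hz1] at hzq
    linear_combination (-(u ^ 2 - u) / 2) * hzq
  · apply hne
    have hz1 : z = -1 := by linear_combination h1 / 2
    rw [hz1] at hzq
    linear_combination ((u ^ 2 - u - 2) / 2) * hzq
  · have h2 : z ^ 2 + 2 * z = j * (2 * z + 1) := by linear_combination h1 / 4
    have h3 : (2 * (u ^ 2 - u)) ^ 2 = -2 := by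
      apply mul_left_cancel₀ (pow_ne_zero 2 hz0)
      linear_combination (-(z + 1) ^ 2 - 2 * z * (u ^ 2 - u)) * hzq
        + (z ^ 2 + 2 * z + j * (2 * z + 1)) * h2 + (2 * z + 1) ^ 2 * hj
    -- normalise the roots
    obtain ⟨s, j, hs, hj, hsj⟩ : ∃ s j : K, s ^ 2 = 2 ∧ j ^ 2 = -1 ∧ 2 * u = 1 + s + j := by
      obtain ⟨s, hsd⟩ : ∃ s, s = -(2 * (u ^ 2 - u)) * j := ⟨_, rfl⟩
      have hs : s ^ 2 = 2 := by rw [hsd]; linear_combination j ^ 2 * h3 - 2 * hj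
      have e : (2 * u - 1) ^ 2 = (s + j) ^ 2 := by
        have : s * j = 2 * (u ^ 2 - u) := by rw [hsd]; linear_combination -(2 * (u ^ 2 - u)) * hj
        linear_combination -hs - hj - 2 * this
      rcases sq_eq_cases e with h | h
      · exact ⟨s, j, hs, hj, by linear_combination h⟩
      · exact ⟨-s, -j, by rw [neg_sq, hs], by rw [neg_sq, hj], by linear_combination h⟩
    have n4672 : ¬ IsSquare (4672 : ℤ) := nsq_of_lt 68 (by norm_num) (by norm_num) (by norm_num)
    rcases k5 with ⟨k, hk⟩ | ⟨k, hk⟩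
    · rw [hk] at f5
      obtain ⟨t, ht⟩ := norm_two hG.span (m := 2 * u * k) hs hj (u := 6) (v := 6) (u' := 6) (v' := 2)
        (by push_cast; linear_combination (-4 * u) * f5 + (2 * u + 4 + 1 + s + j) * hsj + hs + hj)
      exact nsq' 4672 n4672 t (by rw [ht]; norm_num)
    rcases k2 with ⟨k', hk'⟩ | ⟨k', hk'⟩
    · rw [hk'] at f2
      obtain ⟨t, ht⟩ := norm_one hG.span (m := 2 * u * k' * (1 - j)) hs hj (u := 0) (v := 4)
        (by
          push_cast
          linear_combination (-4 * u * (1 - j) ^ 2) * f2 + (1 - j) ^ 2 * (2 * u - 2 + 1 + s + j) * hsj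
            + (1 - j) ^ 2 * (hs + hj) + (2 * s * j - 4 * s) * hj)
      nlinarith [sq_nonneg t]
    · have hm : (2 * u * (δ * k * k')) ^ 2 = (2 * (u + 2)) * (2 * (u - 1)) := by
        rw [f5, f2, hk, hk']; ring
      obtain ⟨t, ht⟩ := norm_two hG.span (m := 2 * u * (δ * k * k')) hs hj
        (u := -4) (v := 4) (u' := 4) (v' := 2)
        (by rw [hm]; push_cast; linear_combination (2 * u + 2 + 1 + s + j) * hsj + hs + hj)
      exact nsq' 4672 n4672 t (by rw [ht]; norm_num)

theorem rational_case (hG : Good K) {δ g : K} (hg : g ≠ 0)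
    (z1 : 1 - 2 * g ≠ 0) (z2 : 1 - g ≠ 0) (z4 : 1 + g ≠ 0) (z5 : 1 + 2 * g ≠ 0)
    (k1 : Cls δ (1 - 2 * g)) (k2 : Cls δ (1 - g)) (k4 : Cls δ (1 + g)) (k5 : Cls δ (1 + 2 * g)) :
    ∃ a1 a2 a4 a5 : K, (1 - 2 * g = a1 ^ 2 ∧ 1 - g = a2 ^ 2 ∧ 1 + g = δ * a4 ^ 2 ∧
      1 + 2 * g = a5 ^ 2) ∨
      (1 - 2 * g = a5 ^ 2 ∧ 1 - g = δ * a4 ^ 2 ∧ 1 + g = a2 ^ 2 ∧ 1 + 2 * g = a1 ^ 2) := by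
  have ev : ∀ y, (1 - 2 * g) * (1 - g) * (1 + g) = y ^ 2 → False := fun y hy =>
    even_case hG hg z1 z2 z4 k2 k4 k5 hy
  have ev' : ∀ y, (1 + 2 * g) * (1 + g) * (1 - g) = y ^ 2 → False := fun y hy => by
    have t : ∀ x : K, 1 - 2 * -g = 1 + 2 * g ∧ 1 - -g = 1 + g ∧ 1 + -g = 1 - g ∧
      1 + 2 * -g = 1 - 2 * g := fun x => ⟨by ring, by ring, by ring, by ring⟩
    obtain ⟨t1, t2, t4, t5⟩ := t 0
    refine even_case hG (g := -g) (y := y) (δ := δ) (neg_ne_zero.mpr hg) ?_ ?_ ?_ ?_ ?_ ?_ ?_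
    · rwa [t1]
    · rwa [t2]
    · rwa [t4]
    · rwa [t2]
    · rwa [t4]
    · rwa [t5]
    · rw [t1, t2, t4, hy]
  obtain ⟨u, hu⟩ : ∃ u, u * g = 1 := ⟨g⁻¹, by field_simp⟩
  have hu0 : u ≠ 0 := by rintro rfl; simp at hu
  have f1 : u - 2 = u * (1 - 2 * g) := by linear_combination 2 * hu
  have f2 : u - 1 = u * (1 - g) := by linear_combination hu
  have f4 : u + 1 = u * (1 + g) := by linear_combination -hu
  have f5 : u + 2 = u * (1 + 2 * g) := by linear_combination -2 * hu
  have last : ∀ p q m, (1 - g) * (1 + g) = p ^ 2 → (1 - 2 * g) * (1 + 2 * g) = q ^ 2 →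
      ((1 - 2 * g) * (1 - g) = m ^ 2 ∨ 1 + g = m ^ 2) → False := by
    intro p q m hp hq hm
    have := hG.G3 u (u * p) (u * q) (u * m)
      (by rw [show u ^ 2 - 1 = (u - 1) * (u + 1) by ring, f2, f4]; linear_combination u ^ 2 * hp)
      (by rw [show u ^ 2 - 4 = (u - 2) * (u + 2) by ring, f1, f5]; linear_combination u ^ 2 * hq)
      (by
        rcases hm with hm | hm
        · left; rw [f1, f2]; linear_combination u ^ 2 * hm
        · right; rw [f4]; linear_combination u ^ 2 * hm)
    have g1 : u - 2 ≠ 0 := by rw [f1]; exact mul_ne_zero hu0 z1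
    have g2 : u - 1 ≠ 0 := by rw [f2]; exact mul_ne_zero hu0 z2
    have g4 : u + 1 ≠ 0 := by rw [f4]; exact mul_ne_zero hu0 z4
    have g5 : u + 2 ≠ 0 := by rw [f5]; exact mul_ne_zero hu0 z5
    rcases this with h | h | h | h | h
    · exact hu0 h
    · exact g2 (by linear_combination h)
    · exact g4 (by linear_combination h)
    · exact g1 (by linear_combination h)
    · exact g5 (by linear_combination h)
  rcases k1 with ⟨r1, e1⟩ | ⟨r1, e1⟩ <;> rcases k2 with ⟨r2, e2⟩ | ⟨r2, e2⟩ <;>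
    rcases k4 with ⟨r4, e4⟩ | ⟨r4, e4⟩
  · exact (ev (r1 * r2 * r4) (by rw [e1, e2, e4]; ring)).elim
  · rcases k5 with ⟨r5, e5⟩ | ⟨r5, e5⟩
    · exact ⟨r1, r2, r4, r5, Or.inl ⟨e1, e2, e4, e5⟩⟩
    · exact (ev' (δ * r5 * r4 * r2) (by rw [e5, e2, e4]; ring)).elim
  · rcases k5 with ⟨r5, e5⟩ | ⟨r5, e5⟩
    · exact ⟨r5, r4, r2, r1, Or.inr ⟨e1, e2, e4, e5⟩⟩
    · exact (ev' (δ * r5 * r4 * r2) (by rw [e5, e2, e4]; ring)).elim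
  · exact (ev (δ * r1 * r2 * r4) (by rw [e1, e2, e4]; ring)).elim
  · rcases k5 with ⟨r5, e5⟩ | ⟨r5, e5⟩
    · exact (ev' (r5 * r4 * r2) (by rw [e5, e2, e4]; ring)).elim
    · exact (last (r2 * r4) (δ * r1 * r5) r4 (by rw [e2, e4]; ring) (by rw [e1, e5]; ring)
        (Or.inr e4)).elim
  · exact (ev (δ * r1 * r2 * r4) (by rw [e1, e2, e4]; ring)).elim
  · exact (ev (δ * r1 * r2 * r4) (by rw [e1, e2, e4]; ring)).elim
  · rcases k5 with ⟨r5, e5⟩ | ⟨r5, e5⟩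
    · exact (ev' (δ * r5 * r4 * r2) (by rw [e5, e2, e4]; ring)).elim
    · exact (last (δ * r2 * r4) (δ * r1 * r5) (δ * r1 * r2) (by rw [e2, e4]; ring)
        (by rw [e1, e5]; ring) (Or.inl (by rw [e1, e2]; ring))).elim

theorem quad_gen {K L : Type*} [Field K] [CharZero K] [Field L] [Algebra K L]
    (hquad : Module.finrank K L = 2) :
    ∃ (θ : L) (δ : K), θ ^ 2 = algebraMap K L δ ∧ (∀ c : K, c ^ 2 ≠ δ) ∧
      (∀ x : L, ∃ A B : K, x = algebraMap K L A + algebraMap K L B * θ) ∧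
      (∀ A B : K, algebraMap K L A + algebraMap K L B * θ = 0 → A = 0 ∧ B = 0) := by
  obtain ⟨x, hx⟩ : ∃ x : L, ∀ a : K, algebraMap K L a ≠ x := by
    by_contra hcon
    push Not at hcon
    have h1 : Module.finrank K L ≤ 1 := finrank_le_one (1 : L) (fun w => by
      obtain ⟨a, ha⟩ := hcon w
      exact ⟨a, by rw [Algebra.smul_def, mul_one, ha]⟩)
    omega
  have inj := (algebraMap K L).injective
  have ind : ∀ A B : K, algebraMap K L A + algebraMap K L B * x = 0 → A = 0 ∧ B = 0 := by
    intro A B h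
    have hB : B = 0 := by
      by_contra hB
      apply hx (-A / B)
      have hB' : algebraMap K L B ≠ 0 := by simpa using hB
      rw [map_div₀, map_neg, div_eq_iff hB']
      linear_combination -h
    refine ⟨?_, hB⟩
    rw [hB] at h
    simpa using h
  have li : LinearIndependent K ![(1 : L), x] := by
    rw [LinearIndependent.pair_iff]
    intro A B h
    apply ind
    rw [Algebra.smul_def, Algebra.smul_def] at h
    linear_combination h
  have sp := li.span_eq_top_of_card_eq_finrank (by simp [hquad])
  have form : ∀ y : L, ∃ A B : K, y = algebraMap K L A + algebraMap K L B * x := by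
    intro y
    have hy : y ∈ Submodule.span K (Set.range ![(1 : L), x]) := by rw [sp]; trivial
    rw [Matrix.range_cons, Matrix.range_cons, Matrix.range_empty, Set.union_empty,
      Set.singleton_union, Submodule.mem_span_pair] at hy
    obtain ⟨A, B, h⟩ := hy
    refine ⟨A, B, ?_⟩
    rw [← h, Algebra.smul_def, Algebra.smul_def, mul_one]
  obtain ⟨b, a, hba⟩ := form (x ^ 2)
  have h2 : algebraMap K L (a / 2) * 2 = algebraMap K L a := by
    rw [← map_ofNat (algebraMap K L) 2, ← map_mul]; congr 1; ring
  have hsq : (x - algebraMap K L (a / 2)) ^ 2 = algebraMap K L (b + (a / 2) ^ 2) := by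
    rw [map_add, map_pow]
    linear_combination hba - x * h2
  refine ⟨x - algebraMap K L (a / 2), b + (a / 2) ^ 2, hsq, ?_, ?_, ?_⟩
  · intro c hc
    rw [← hc, map_pow] at hsq
    rcases sq_eq_cases hsq with h | h
    · exact hx (c + a / 2) (by rw [map_add]; linear_combination -h)
    · exact hx (-c + a / 2) (by rw [map_add, map_neg]; linear_combination -h)
  · intro y
    obtain ⟨A, B, h⟩ := form y
    refine ⟨A + B * (a / 2), B, ?_⟩
    rw [h, map_add, map_mul]; ring
  · intro A B h
    obtain ⟨hA, hB⟩ := ind (A - B * (a / 2)) B (by rw [map_sub, map_mul]; linear_combination h)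
    refine ⟨?_, hB⟩
    rw [hB] at hA
    simpa using hA

end

theorem hAP_scaled {L : Type*} [Field L] {b₁ b₂ b₃ b₄ b₅ : L}
    (hAP : b₁ ^ 2 + b₃ ^ 2 = 2 * b₂ ^ 2 ∧ b₂ ^ 2 + b₄ ^ 2 = 2 * b₃ ^ 2 ∧
      b₃ ^ 2 + b₅ ^ 2 = 2 * b₄ ^ 2) (h3 : b₃ ≠ 0) :
    (b₁ / b₃) ^ 2 = 1 - 2 * ((b₄ / b₃) ^ 2 - 1) ∧ (b₂ / b₃) ^ 2 = 1 - ((b₄ / b₃) ^ 2 - 1) ∧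
    (b₄ / b₃) ^ 2 = 1 + ((b₄ / b₃) ^ 2 - 1) ∧ (b₅ / b₃) ^ 2 = 1 + 2 * ((b₄ / b₃) ^ 2 - 1) := by
  obtain ⟨h1, h2, h4⟩ := hAP
  refine ⟨?_, ?_, by ring, ?_⟩
  · field_simp; linear_combination h1 + 2 * h2
  · field_simp; linear_combination h2
  · field_simp; linear_combination h4

theorem five_squares_over_quadratic_ext_class_number_one
    (K L : Type*) [Field K] [NumberField K] [Field L] [NumberField L] [Algebra K L]
    (hquad : Module.finrank K L = 2)
    (hKcyc : ¬ IsCyclotomicExtension {12} ℚ K)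
    (hclass : NumberField.classNumber K = 1)
    (hcond : condA K ∨ condB K)
    (b₁ b₂ b₃ b₄ b₅ : L)
    (hAP : b₁ ^ 2 + b₃ ^ 2 = 2 * b₂ ^ 2 ∧ b₂ ^ 2 + b₄ ^ 2 = 2 * b₃ ^ 2 ∧
      b₃ ^ 2 + b₅ ^ 2 = 2 * b₄ ^ 2)
    (hnz : b₁ ≠ 0 ∧ b₂ ≠ 0 ∧ b₃ ≠ 0 ∧ b₄ ≠ 0 ∧ b₅ ≠ 0)
    (hnc : ¬ (b₁ ^ 2 = b₂ ^ 2 ∧ b₂ ^ 2 = b₃ ^ 2 ∧ b₃ ^ 2 = b₄ ^ 2 ∧ b₄ ^ 2 = b₅ ^ 2))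
    (hproper : IntermediateField.adjoin ℚ ({b₁, b₂, b₃, b₄, b₅} : Set L) = ⊤) :
    ∃ (a₁ a₂ a₃ a₄ a₅ α : K) (s : L), s ≠ 0 ∧ (¬ ∃ c : K, c ^ 2 = α) ∧
      ((s ^ 2 * b₁ ^ 2 = algebraMap K L (a₁ ^ 2) ∧
        s ^ 2 * b₂ ^ 2 = algebraMap K L (a₂ ^ 2) ∧
        s ^ 2 * b₃ ^ 2 = algebraMap K L (a₃ ^ 2) ∧
        s ^ 2 * b₄ ^ 2 = algebraMap K L (α * a₄ ^ 2) ∧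
        s ^ 2 * b₅ ^ 2 = algebraMap K L (a₅ ^ 2)) ∨
       (s ^ 2 * b₁ ^ 2 = algebraMap K L (a₅ ^ 2) ∧
        s ^ 2 * b₂ ^ 2 = algebraMap K L (α * a₄ ^ 2) ∧
        s ^ 2 * b₃ ^ 2 = algebraMap K L (a₃ ^ 2) ∧
        s ^ 2 * b₄ ^ 2 = algebraMap K L (a₂ ^ 2) ∧
        s ^ 2 * b₅ ^ 2 = algebraMap K L (a₁ ^ 2))) := by
  have hG : Good K := by
    rcases hcond with h | h
    · exact good_of_condA h
    · exact good_of_condB hKcyc h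
  obtain ⟨θ, δ, hθ, hδ, form, ind⟩ := quad_gen (K := K) (L := L) hquad
  have hδ0 : δ ≠ 0 := by
    rintro rfl
    exact hδ 0 (by ring)
  obtain ⟨h1, h2, h4, h5⟩ := hAP_scaled hAP hnz.2.2.1
  obtain ⟨n1, n2, n3, n4, n5⟩ := hnz
  obtain ⟨A1, B1, f1⟩ := form (b₁ / b₃)
  obtain ⟨A2, B2, f2⟩ := form (b₂ / b₃)
  obtain ⟨A4, B4, f4⟩ := form (b₄ / b₃)
  obtain ⟨A5, B5, f5⟩ := form (b₅ / b₃)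
  have m1 : b₁ / b₃ ≠ 0 := div_ne_zero n1 n3
  have m2 : b₂ / b₃ ≠ 0 := div_ne_zero n2 n3
  have m4 : b₄ / b₃ ≠ 0 := div_ne_zero n4 n3
  have m5 : b₅ / b₃ ≠ 0 := div_ne_zero n5 n3
  have w1 : b₁ ^ 2 = (b₁ / b₃) ^ 2 * b₃ ^ 2 := by field_simp
  have w2 : b₂ ^ 2 = (b₂ / b₃) ^ 2 * b₃ ^ 2 := by field_simp
  have w4 : b₄ ^ 2 = (b₄ / b₃) ^ 2 * b₃ ^ 2 := by field_simp
  have w5 : b₅ ^ 2 = (b₅ / b₃) ^ 2 * b₃ ^ 2 := by field_simp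
  generalize b₁ / b₃ = β1 at *
  generalize b₂ / b₃ = β2 at *
  generalize b₄ / b₃ = β4 at *
  generalize b₅ / b₃ = β5 at *
  obtain ⟨g, hg⟩ : ∃ g, g = A4 ^ 2 + δ * B4 ^ 2 - 1 := ⟨_, rfl⟩
  obtain ⟨h, hh⟩ : ∃ h, h = A4 * B4 := ⟨_, rfl⟩
  have sq : ∀ A B : K, (algebraMap K L A + algebraMap K L B * θ) ^ 2 =
      algebraMap K L (A ^ 2 + δ * B ^ 2) + algebraMap K L (2 * (A * B)) * θ := by
    intro A B
    simp only [map_add, map_mul, map_pow, map_ofNat]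
    linear_combination (algebraMap K L B) ^ 2 * hθ
  have hd : β4 ^ 2 - 1 = algebraMap K L g + algebraMap K L (2 * h) * θ := by
    rw [f4, sq, hg, hh, map_sub, map_one]; ring
  have key : ∀ (A B v : K) (β : L), β = algebraMap K L A + algebraMap K L B * θ →
      β ^ 2 = 1 + algebraMap K L v * (β4 ^ 2 - 1) →
      A * B = v * h ∧ A ^ 2 + δ * B ^ 2 = 1 + v * g := by
    intro A B v β hβ e
    rw [hβ, sq, hd] at e
    obtain ⟨i1, i2⟩ := ind (A ^ 2 + δ * B ^ 2 - (1 + v * g)) (2 * (A * B) - v * (2 * h)) (by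
      simp only [map_sub, map_add, map_mul, map_pow, map_ofNat, map_one] at e ⊢
      linear_combination e)
    exact ⟨by linear_combination i2 / 2, by linear_combination i1⟩
  obtain ⟨p1, s1⟩ := key A1 B1 (-2) β1 f1 (by rw [map_neg, map_ofNat, h1]; ring)
  obtain ⟨p2, s2⟩ := key A2 B2 (-1) β2 f2 (by rw [map_neg, map_one, h2]; ring)
  obtain ⟨p4, s4⟩ := key A4 B4 1 β4 f4 (by rw [map_one]; ring)
  obtain ⟨p5, s5⟩ := key A5 B5 2 β5 f5 (by rw [map_ofNat, h5])
  have h0 : h = 0 := h_eq_zero hG hδ0 p1 (by rw [p2]; ring) (by rw [p4]; ring) p5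
    (by rw [s1]; ring) (by rw [s2]; ring) (by rw [s4]; ring) s5
  rw [h0, mul_zero] at p1 p2 p4 p5
  have hd' : β4 ^ 2 - 1 = algebraMap K L g := by rw [hd, h0]; simp
  rw [hd'] at h1 h2 h5
  have c1 : β1 ^ 2 = algebraMap K L (1 - 2 * g) := by
    rw [h1, map_sub, map_one, map_mul, map_ofNat]
  have c2 : β2 ^ 2 = algebraMap K L (1 - g) := by
    rw [h2, map_sub, map_one]
  have c4 : β4 ^ 2 = algebraMap K L (1 + g) := by
    rw [map_add, map_one]; linear_combination hd'
  have c5 : β5 ^ 2 = algebraMap K L (1 + 2 * g) := by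
    rw [h5, map_add, map_one, map_mul, map_ofNat]
  have nz : ∀ (β : L) (c : K), β ≠ 0 → β ^ 2 = algebraMap K L c → c ≠ 0 := by
    rintro β c hβ e rfl
    apply hβ
    rw [map_zero] at e
    exact pow_eq_zero_iff two_ne_zero |>.mp e
  have cls : ∀ A B c : K, A * B = 0 → A ^ 2 + δ * B ^ 2 = c → Cls δ c := by
    intro A B c hAB e
    rcases mul_eq_zero.mp hAB with h | h
    · right; exact ⟨B, by rw [← e, h]; ring⟩
    · left; exact ⟨A, by rw [← e, h]; ring⟩
  have hg0 : g ≠ 0 := by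
    intro hg0
    apply hnc
    rw [w1, w2, w4, w5, c1, c2, c4, c5, hg0]
    simp
  obtain ⟨a1, a2, a4, a5, H⟩ := rational_case hG (δ := δ) hg0 (nz _ _ m1 c1) (nz _ _ m2 c2)
    (nz _ _ m4 c4) (nz _ _ m5 c5) (cls A1 B1 _ p1 (by rw [s1]; ring))
    (cls A2 B2 _ p2 (by rw [s2]; ring)) (cls A4 B4 _ p4 (by rw [s4]; ring))
    (cls A5 B5 _ p5 s5)
  have fin : ∀ (b β : L) (c : K), b ^ 2 = β ^ 2 * b₃ ^ 2 → β ^ 2 = algebraMap K L c →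
      b₃⁻¹ ^ 2 * b ^ 2 = algebraMap K L c := by
    intro b β c e1 e2
    rw [e1, e2]; field_simp
  refine ⟨a1, a2, 1, a4, a5, δ, b₃⁻¹, inv_ne_zero n3, fun ⟨c, hc⟩ => hδ c hc, ?_⟩
  have e3 : b₃⁻¹ ^ 2 * b₃ ^ 2 = algebraMap K L (1 ^ 2) := by
    rw [one_pow, map_one]; field_simp
  rcases H with ⟨r1, r2, r4, r5⟩ | ⟨r1, r2, r4, r5⟩
  · left
    rw [← r1, ← r2, ← r4, ← r5]
    exact ⟨fin _ _ _ w1 c1, fin _ _ _ w2 c2, e3, fin _ _ _ w4 c4, fin _ _ _ w5 c5⟩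
  · right
    rw [← r1, ← r2, ← r4, ← r5]
    exact ⟨fin _ _ _ w1 c1, fin _ _ _ w2 c2, e3, fin _ _ _ w4 c4, fin _ _ _ w5 c5⟩
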